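/- arXiv:math/0607533 — 4 statements merged into one kernel-verified Lean document; each statement's English description precedes it below -/
import Mathlib

section
/- Let V be an n-dimensional vector space over a finite field F_q, let 1 ≤ r ≤ k ≤ n/2 be integers, and let G be a group acting linearly on V. Then the number of G-orbits on the Grassmannian G(r,V) of r-dimensional subspaces of V is at most the number of G-orbits on the Grassmannian G(k,V) of k-dimensional subspaces. -/
/-- The number of orbits of a group `G`, acting linearly on `V` through `ρ`,
on the Grassmannian of `m`-dimensional subspaces of `V`, counted as the number
of orbit sets. -/
noncomputable def grassOrbitCount (F V G : Type*) [Field F] [AddCommGroup V] [Module F V]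
    [Group G] (ρ : G →* (V ≃ₗ[F] V)) (m : ℕ) : ℕ :=
  Nat.card {s : Set {W : Submodule F V // Module.finrank F W = m} //
    ∃ W₀ : {W : Submodule F V // Module.finrank F W = m},
      s = {W : {W : Submodule F V // Module.finrank F W = m} | ∃ g : G,
        (W : Submodule F V) = Submodule.map ((ρ g) : V →ₗ[F] V) (W₀ : Submodule F V)}}

open Classical in
theorem aux_count {F V : Type*} [Field F] [AddCommGroup V] [Module F V]
    [FiniteDimensional F V] [Fintype (Submodule F V)] (s : ℕ)
    (hs : 2 * (s + 1) < Module.finrank F V) (X : Submodule F V)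
    (hX : Module.finrank F X = s + 1) :
    (Finset.univ.filter (fun Z : Submodule F V => Module.finrank F Z = s ∧ Z ≤ X)).card <
    (Finset.univ.filter (fun W : Submodule F V => Module.finrank F W = s + 2 ∧ X ≤ W)).card := by
  have hq : Module.finrank F (V ⧸ X) + Module.finrank F X = Module.finrank F V :=
    Submodule.finrank_quotient_add_finrank X
  have hd : Module.finrank F (Module.Dual F X) = s + 1 := by
    rw [Subspace.dual_finrank_eq, hX]
  obtain ⟨φ, hφ⟩ : ∃ φ : Module.Dual F X →ₗ[F] (V ⧸ X), Function.Injective φ := by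
    apply finrank_le_iff_exists_linearMap.1
    omega
  have hcomap : ∀ L : Submodule F (V ⧸ X), Module.finrank F L = 1 →
      Module.finrank F (L.comap X.mkQ) = s + 2 := by
    intro L hL
    have h1 := LinearMap.finrank_range_add_finrank_ker (X.mkQ.domRestrict (L.comap X.mkQ))
    have h2 : LinearMap.range (X.mkQ.domRestrict (L.comap X.mkQ)) = L := by
      rw [LinearMap.range_domRestrict, Submodule.map_comap_eq_of_surjective X.mkQ_surjective]
    have h3 : Module.finrank F (LinearMap.ker (X.mkQ.domRestrict (L.comap X.mkQ))) = s + 1 := by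
      rw [LinearMap.ker_domRestrict, ← hX, Submodule.ker_mkQ]
      exact (Submodule.comapSubtypeEquivOfLe (Submodule.le_comap_mkQ X L)).finrank_eq
    rw [h2, h3, hL] at h1
    omega
  have hinjc : Function.Injective (Submodule.comap X.mkQ) :=
    Submodule.comap_injective_of_surjective X.mkQ_surjective
  let Φ : Submodule F V → Submodule F V := fun Z =>
    (((Z.comap X.subtype).dualAnnihilator).map φ).comap X.mkQ
  rw [← Finset.card_image_of_injOn (f := Φ)]
  · apply Finset.card_lt_card
    rw [Finset.ssubset_iff_of_subset]
    · obtain ⟨v, hv⟩ : ∃ v, v ∉ LinearMap.range φ := by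
        by_contra! hcon
        have : LinearMap.range φ = ⊤ := by
          rw [eq_top_iff]; intro v _; exact hcon v
        have h2 := LinearMap.finrank_range_of_inj hφ
        rw [this, finrank_top] at h2
        omega
      have hv0 : v ≠ 0 := fun h => hv (h ▸ zero_mem _)
      refine ⟨(Submodule.span F {v}).comap X.mkQ, ?_, ?_⟩
      · simp only [Finset.mem_filter, Finset.mem_univ, true_and]
        exact ⟨hcomap _ (finrank_span_singleton hv0), Submodule.le_comap_mkQ X _⟩
      · simp only [Finset.mem_image, not_exists, not_and]
        intro Z _ hZ
        have := hinjc hZ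
        apply hv
        have h2 : v ∈ Submodule.span F {v} := Submodule.mem_span_singleton_self v
        rw [← this] at h2
        exact LinearMap.map_le_range h2
    · intro W hW
      simp only [Finset.mem_image, Finset.mem_filter, Finset.mem_univ, true_and] at hW ⊢
      obtain ⟨Z, ⟨hZ, hZX⟩, rfl⟩ := hW
      refine ⟨hcomap _ ?_, Submodule.le_comap_mkQ X _⟩
      rw [← (Submodule.equivMapOfInjective φ hφ _).finrank_eq]
      have h1 := Subspace.finrank_add_finrank_dualAnnihilator_eq (Z.comap X.subtype)
      have h2 := (Submodule.comapSubtypeEquivOfLe hZX).finrank_eq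
      omega
  · intro Z hZ Z' hZ' h
    simp only [Finset.coe_filter, Finset.mem_univ, true_and, Set.mem_ofPred_eq] at hZ hZ'
    have h1 := Submodule.map_injective_of_injective hφ (hinjc h)
    have h2 := Subspace.dualAnnihilator_inj.1 h1
    have h3 := congrArg (Submodule.map X.subtype) h2
    rwa [Submodule.map_comap_subtype, Submodule.map_comap_subtype, inf_eq_right.2 hZ.2,
      inf_eq_right.2 hZ'.2] at h3

open Classical in
theorem aux_offdiag {F V : Type*} [Field F] [AddCommGroup V] [Module F V]
    [FiniteDimensional F V] [Fintype (Submodule F V)] (s : ℕ)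
    (X Y : Submodule F V) (hXY : X ≠ Y)
    (hX : Module.finrank F X = s + 1) (hY : Module.finrank F Y = s + 1) :
    (Finset.univ.filter (fun Z : Submodule F V =>
      Module.finrank F Z = s ∧ Z ≤ X ∧ Z ≤ Y)).card =
    (Finset.univ.filter (fun W : Submodule F V =>
      Module.finrank F W = s + 2 ∧ X ≤ W ∧ Y ≤ W)).card := by
  have hdim := Submodule.finrank_sup_add_finrank_inf_eq X Y
  have hlt : s + 1 < Module.finrank F (X ⊔ Y : Submodule F V) := by
    rw [← hX]
    apply Submodule.finrank_lt_finrank_of_lt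
    refine lt_of_le_of_ne le_sup_left fun h => hXY ?_
    have : Y ≤ X := by rw [h]; exact le_sup_right
    exact (Submodule.eq_of_le_of_finrank_eq this (by omega)).symm
  by_cases hc : Module.finrank F (X ⊔ Y : Submodule F V) = s + 2
  · have e1 : (Finset.univ.filter (fun Z : Submodule F V =>
      Module.finrank F Z = s ∧ Z ≤ X ∧ Z ≤ Y)) = {X ⊓ Y} := by
      ext Z
      simp only [Finset.mem_filter, Finset.mem_univ, true_and, Finset.mem_singleton]
      constructor
      · rintro ⟨h1, h2, h3⟩
        exact Submodule.eq_of_le_of_finrank_eq (le_inf h2 h3) (by omega)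
      · rintro rfl
        exact ⟨by omega, inf_le_left, inf_le_right⟩
    have e2 : (Finset.univ.filter (fun W : Submodule F V =>
      Module.finrank F W = s + 2 ∧ X ≤ W ∧ Y ≤ W)) = {X ⊔ Y} := by
      ext Z
      simp only [Finset.mem_filter, Finset.mem_univ, true_and, Finset.mem_singleton]
      constructor
      · rintro ⟨h1, h2, h3⟩
        exact (Submodule.eq_of_le_of_finrank_eq (sup_le h2 h3) (by omega)).symm
      · rintro rfl
        exact ⟨by omega, le_sup_left, le_sup_right⟩
    rw [e1, e2]; simp
  · rw [Finset.filter_false_of_mem, Finset.filter_false_of_mem]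
    · rintro W - ⟨h1, h2, h3⟩
      have := Submodule.finrank_mono (sup_le h2 h3)
      omega
    · rintro W - ⟨h1, h2, h3⟩
      have := Submodule.finrank_mono (le_inf h2 h3)
      omega

theorem aux_sq {α : Type*} [Fintype α] (P : α → Prop) (Q : α → Prop) (R : α → α → Prop)
    [DecidablePred P] [DecidablePred Q] [∀ X W, Decidable (R X W)]
    (f : α → ℚ) :
    ∑ W ∈ Finset.univ.filter P, (∑ X ∈ Finset.univ.filter (fun X => Q X ∧ R X W), f X) ^ 2 =
    ∑ X ∈ Finset.univ.filter Q, ∑ Y ∈ Finset.univ.filter Q,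
      f X * f Y * ((Finset.univ.filter (fun W => P W ∧ R X W ∧ R Y W)).card : ℚ) := by
  have h1 : ∀ X Y, ((Finset.univ.filter (fun W => P W ∧ R X W ∧ R Y W)).card : ℚ) =
      ∑ W ∈ Finset.univ.filter P, (if R X W then 1 else 0) * (if R Y W then 1 else 0) := by
    intro X Y
    rw [← Finset.filter_filter, Finset.card_filter]
    push_cast
    refine Finset.sum_congr rfl fun W _ => ?_
    by_cases a : R X W <;> by_cases b : R Y W <;> simp [a, b]
  simp_rw [h1, Finset.mul_sum]
  simp_rw [Finset.sum_comm (s := Finset.univ.filter Q) (t := Finset.univ.filter P)]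
  refine Finset.sum_congr rfl fun W _ => ?_
  rw [← Finset.filter_filter, Finset.sum_filter, sq, Finset.sum_mul_sum]
  refine Finset.sum_congr rfl fun X _ => Finset.sum_congr rfl fun Y _ => ?_
  by_cases a : R X W <;> by_cases b : R Y W <;> simp [a, b]

open Classical in
theorem aux_inj {F V : Type*} [Field F] [AddCommGroup V] [Module F V]
    [FiniteDimensional F V] [Fintype (Submodule F V)] (s : ℕ)
    (hs : 2 * (s + 1) < Module.finrank F V) (f : Submodule F V → ℚ)
    (hf : ∀ W : Submodule F V, Module.finrank F W = s + 2 →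
      ∑ X ∈ Finset.univ.filter (fun X : Submodule F V => Module.finrank F X = s + 1 ∧ X ≤ W),
        f X = 0) (X : Submodule F V) (hX : Module.finrank F X = s + 1) : f X = 0 := by
  have h1 := aux_sq (fun W : Submodule F V => Module.finrank F W = s + 2)
    (fun W : Submodule F V => Module.finrank F W = s + 1) (fun X W => X ≤ W) f
  have h2 := aux_sq (fun W : Submodule F V => Module.finrank F W = s)
    (fun W : Submodule F V => Module.finrank F W = s + 1) (fun X W => W ≤ X) f
  rw [Finset.sum_eq_zero] at h1
  swap
  · intro W hW
    rw [hf W (Finset.mem_filter.1 hW).2]; norm_num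
  have h3 : (0 : ℚ) ≤ ∑ X ∈ Finset.univ.filter (fun W : Submodule F V => Module.finrank F W = s + 1),
      ∑ Y ∈ Finset.univ.filter (fun W : Submodule F V => Module.finrank F W = s + 1),
      f X * f Y * ((Finset.univ.filter (fun W : Submodule F V =>
        Module.finrank F W = s ∧ W ≤ X ∧ W ≤ Y)).card : ℚ) := by
    rw [← h2]
    exact Finset.sum_nonneg fun _ _ => sq_nonneg _
  set c : Submodule F V → ℚ := fun X =>
    ((Finset.univ.filter (fun W : Submodule F V => Module.finrank F W = s + 2 ∧ X ≤ W)).card : ℚ) -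
    ((Finset.univ.filter (fun Z : Submodule F V => Module.finrank F Z = s ∧ Z ≤ X)).card : ℚ)
    with hc
  have h4 : (0 : ℚ) - ∑ X ∈ Finset.univ.filter (fun W : Submodule F V => Module.finrank F W = s + 1),
      ∑ Y ∈ Finset.univ.filter (fun W : Submodule F V => Module.finrank F W = s + 1),
      f X * f Y * ((Finset.univ.filter (fun W : Submodule F V =>
        Module.finrank F W = s ∧ W ≤ X ∧ W ≤ Y)).card : ℚ) =
      ∑ X ∈ Finset.univ.filter (fun W : Submodule F V => Module.finrank F W = s + 1),
        f X ^ 2 * c X := by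
    rw [h1, ← Finset.sum_sub_distrib]
    refine Finset.sum_congr rfl fun X hX => ?_
    rw [← Finset.sum_sub_distrib, Finset.sum_eq_single_of_mem X hX]
    · simp only [hc, and_self]; ring
    · intro Y hY hYX
      rw [aux_offdiag s X Y hYX.symm (Finset.mem_filter.1 hX).2 (Finset.mem_filter.1 hY).2]
      ring
  have hcpos : ∀ X : Submodule F V, Module.finrank F X = s + 1 → 0 < c X := by
    intro X hX
    have := aux_count s hs X hX
    simp only [hc, sub_pos]
    exact_mod_cast this
  have hnn : ∀ X ∈ Finset.univ.filter (fun W : Submodule F V => Module.finrank F W = s + 1),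
      0 ≤ f X ^ 2 * c X := fun X hX =>
    mul_nonneg (sq_nonneg _) (hcpos X (Finset.mem_filter.1 hX).2).le
  have h5 := Finset.sum_nonneg hnn
  have h6 := (Finset.sum_eq_zero_iff_of_nonneg hnn).1 (by linarith) X (by simp [hX])
  rcases mul_eq_zero.1 h6 with h | h
  · exact pow_eq_zero_iff (two_ne_zero) |>.1 h
  · exact absurd h (hcpos X hX).ne'

open Classical in
theorem aux_step {F V G : Type*} [Field F] [Fintype F] [AddCommGroup V] [Module F V]
    [FiniteDimensional F V] [Group G] (ρ : G →* (V ≃ₗ[F] V)) (s : ℕ)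
    (hs : 2 * (s + 1) < Module.finrank F V) :
    grassOrbitCount F V G ρ (s + 1) ≤ grassOrbitCount F V G ρ (s + 2) := by
  have : Finite V := Module.finite_of_finite F
  have : Finite (Submodule F V) :=
    Finite.of_injective (fun W : Submodule F V => (W : Set V)) SetLike.coe_injective
  let : Fintype (Submodule F V) := Fintype.ofFinite _
  let Gr : ℕ → Type _ := fun m => {W : Submodule F V // Module.finrank F W = m}
  let orb : ∀ m, Gr m → Set (Gr m) := fun m W₀ =>
    {W | ∃ g : G, (W : Submodule F V) = Submodule.map ((ρ g) : V →ₗ[F] V) (W₀ : Submodule F V)}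
  let O : ℕ → Type _ := fun m => {t : Set (Gr m) // ∃ W₀ : Gr m, t = orb m W₀}
  show Nat.card (O (s + 1)) ≤ Nat.card (O (s + 2))
  have : ∀ m, Finite (Gr m) := fun m => Subtype.finite
  have : ∀ m, Finite (O m) := fun m => Subtype.finite
  let : ∀ m, Fintype (O m) := fun m => Fintype.ofFinite _
  have hmul : ∀ (g h : G) (W : Submodule F V),
      Submodule.map ((ρ g) : V →ₗ[F] V) (Submodule.map ((ρ h) : V →ₗ[F] V) W) =
      Submodule.map ((ρ (g * h)) : V →ₗ[F] V) W := by
    intro g h W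
    rw [← Submodule.map_comp, map_mul]; rfl
  have hone : ∀ (W : Submodule F V), Submodule.map ((ρ 1) : V →ₗ[F] V) W = W := by
    intro W
    rw [map_one]; exact Submodule.map_id W
  have hfr : ∀ (g : G) (W : Submodule F V),
      Module.finrank F (Submodule.map ((ρ g) : V →ₗ[F] V) W) = Module.finrank F W :=
    fun g W => LinearEquiv.finrank_map_eq (ρ g) W
  have horb : ∀ m (W W' : Gr m) (g : G),
      (W' : Submodule F V) = Submodule.map ((ρ g) : V →ₗ[F] V) W → orb m W' = orb m W := by
    intro m W W' g hg
    ext Y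
    constructor
    · rintro ⟨h, hh⟩
      exact ⟨h * g, by rw [hh, hg, hmul]⟩
    · rintro ⟨h, hh⟩
      exact ⟨h * g⁻¹, by rw [hh, hg, hmul, inv_mul_cancel_right]⟩
  let ext : (O (s + 1) → ℚ) → Submodule F V → ℚ := fun h X =>
    if hX : Module.finrank F X = s + 1 then h ⟨orb (s + 1) ⟨X, hX⟩, ⟨X, hX⟩, rfl⟩ else 0
  have hext : ∀ h (g : G) X, ext h (Submodule.map ((ρ g) : V →ₗ[F] V) X) = ext h X := by
    intro h g X
    by_cases hX : Module.finrank F X = s + 1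
    · have hX' : Module.finrank F (Submodule.map ((ρ g) : V →ₗ[F] V) X) = s + 1 := by
        rw [hfr, hX]
      simp only [ext, dif_pos hX, dif_pos hX']
      congr 2
      exact horb (s + 1) ⟨X, hX⟩ ⟨_, hX'⟩ g rfl
    · have hX' : ¬ Module.finrank F (Submodule.map ((ρ g) : V →ₗ[F] V) X) = s + 1 := by
        rw [hfr]; exact hX
      simp only [ext, dif_neg hX, dif_neg hX']
  let U : (O (s + 1) → ℚ) → Submodule F V → ℚ := fun h W =>
    ∑ X ∈ Finset.univ.filter (fun X : Submodule F V => Module.finrank F X = s + 1 ∧ X ≤ W), ext h X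
  have hU : ∀ h (g : G) W, U h (Submodule.map ((ρ g) : V →ₗ[F] V) W) = U h W := by
    intro h g W
    symm
    refine Finset.sum_bij' (fun X _ => Submodule.map ((ρ g) : V →ₗ[F] V) X)
      (fun X _ => Submodule.map ((ρ g⁻¹) : V →ₗ[F] V) X) ?_ ?_ ?_ ?_ ?_
    · intro X hX
      simp only [Finset.mem_filter, Finset.mem_univ, true_and] at hX ⊢
      exact ⟨by rw [hfr, hX.1], Submodule.map_mono hX.2⟩
    · intro X hX
      simp only [Finset.mem_filter, Finset.mem_univ, true_and] at hX ⊢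
      refine ⟨by rw [hfr, hX.1], ?_⟩
      have := Submodule.map_mono (f := ((ρ g⁻¹) : V →ₗ[F] V)) hX.2
      rwa [hmul, inv_mul_cancel, hone] at this
    · intro X _
      rw [hmul, inv_mul_cancel, hone]
    · intro X _
      rw [hmul, mul_inv_cancel, hone]
    · intro X _
      rw [hext]
  let rep : O (s + 2) → Gr (s + 2) := fun o => o.2.choose
  have hrep : ∀ o : O (s + 2), o.1 = orb _ (rep o) := fun o => o.2.choose_spec
  let L : (O (s + 1) → ℚ) →ₗ[ℚ] (O (s + 2) → ℚ) :=
    { toFun := fun h o => U h (rep o).1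
      map_add' := by
        intro a b
        funext o
        simp only [U, Pi.add_apply, ← Finset.sum_add_distrib]
        refine Finset.sum_congr rfl fun X hX => ?_
        have := (Finset.mem_filter.1 hX).2.1
        simp only [ext, dif_pos this, Pi.add_apply]
      map_smul' := by
        intro a b
        funext o
        simp only [U, Pi.smul_apply, Finset.smul_sum]
        refine Finset.sum_congr rfl fun X hX => ?_
        have := (Finset.mem_filter.1 hX).2.1
        simp only [ext, dif_pos this, Pi.smul_apply, RingHom.id_apply] }
  have hL : Function.Injective L := by
    rw [injective_iff_map_eq_zero]
    intro h hh
    have key := aux_inj s hs (ext h) (by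
      intro W hW
      have hmem : (⟨W, hW⟩ : Gr (s + 2)) ∈ orb _ ⟨W, hW⟩ := ⟨1, (hone W).symm⟩
      have h1 := hrep ⟨orb _ ⟨W, hW⟩, ⟨W, hW⟩, rfl⟩
      change orb _ _ = _ at h1
      rw [h1] at hmem
      obtain ⟨g, hg⟩ := hmem
      have h2 : U h W = 0 := by
        have hg' : W = _ := hg
        rw [hg', hU]
        exact congrFun hh _
      exact h2)
    funext o
    obtain ⟨_, ⟨X, hX⟩, rfl⟩ := o
    have := key X hX
    simp only [ext, dif_pos hX] at this
    exact this
  have := LinearMap.finrank_le_finrank_of_injective hL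
  rw [Module.finrank_fintype_fun_eq_card, Module.finrank_fintype_fun_eq_card] at this
  rwa [Nat.card_eq_fintype_card, Nat.card_eq_fintype_card]

theorem stmt2 {F V G : Type*} [Field F] [Fintype F] [AddCommGroup V] [Module F V]
    [FiniteDimensional F V] [Group G] (ρ : G →* (V ≃ₗ[F] V))
    (n r k : ℕ) (hn : Module.finrank F V = n)
    (hr : 1 ≤ r) (hrk : r ≤ k) (hk : 2 * k ≤ n) :
    grassOrbitCount F V G ρ r ≤ grassOrbitCount F V G ρ k := by
  induction k, hrk using Nat.le_induction with
  | base => exact le_rfl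
  | succ m hm ih =>
    refine (ih (by omega)).trans ?_
    obtain ⟨s, rfl⟩ : ∃ s, m = s + 1 := ⟨m - 1, by omega⟩
    exact aux_step ρ s (by omega)
end

section
/- Let V be an n-dimensional vector space over a finite field F_q and let G be a group acting linearly on V. For any 1 ≤ k ≤ n-1, the number of G-orbits on the Grassmannian of k-dimensional subspaces of V equals the number of G-orbits on the Grassmannian of (n-k)-dimensional subspaces of V. -/
open Polynomial in
def HasForm (F M : Type*) [Field F] [AddCommGroup M] [Module F M] [Module F[X] M] : Prop :=
  ∃ B : M →ₗ[F] M →ₗ[F] F, (∀ v w, B v w = B w v) ∧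
    (∀ v w, B ((X : F[X]) • v) w = B v ((X : F[X]) • w)) ∧ (∀ v, (∀ w, B v w = 0) → v = 0)

open Polynomial in
theorem hasForm_cyclic_monic {F : Type*} [Field F] (q : F[X]) (hq : q.Monic) :
    HasForm F (F[X] ⧸ (Ideal.span {q} : Ideal F[X])) := by
  let I : Ideal F[X] := Ideal.span {q}
  let l : (F[X] ⧸ I) →ₗ[F] F := (lcoeff F (q.natDegree - 1)) ∘ₗ (AdjoinRoot.modByMonicHom hq)
  have hl : ∀ p : F[X], l (Ideal.Quotient.mk I p) = (p %ₘ q).coeff (q.natDegree - 1) := by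
    intro p
    rfl
  let B : (F[X] ⧸ I) →ₗ[F] (F[X] ⧸ I) →ₗ[F] F := (LinearMap.mul F (F[X] ⧸ I)).compr₂ l
  have hB : ∀ a b, B a b = l (a * b) := fun a b => rfl
  have hX : ∀ a : F[X] ⧸ I, (X : F[X]) • a = Ideal.Quotient.mk I X * a := by
    intro a
    obtain ⟨p, rfl⟩ := Ideal.Quotient.mk_surjective a
    rfl
  refine ⟨B, ?_, ?_, ?_⟩
  · intro v w
    rw [hB, hB, mul_comm]
  · intro v w
    rw [hB, hB, hX, hX]
    congr 1
    ring
  · intro v hv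
    obtain ⟨p, rfl⟩ := Ideal.Quotient.mk_surjective v
    by_contra hne
    have hr : Ideal.Quotient.mk I p = Ideal.Quotient.mk I (p %ₘ q) := by
      rw [Ideal.Quotient.eq, Ideal.mem_span_singleton]
      refine ⟨p /ₘ q, ?_⟩
      have := modByMonic_add_div p q
      linear_combination -this
    rw [hr] at hne hv
    set r := p %ₘ q with hrdef
    have hr0 : r ≠ 0 := by
      rintro h
      rw [h] at hne
      exact hne (map_zero _)
    have hdeg : r.degree < q.degree := degree_modByMonic_lt p hq
    have hnd : r.natDegree < q.natDegree := natDegree_lt_natDegree hr0 hdeg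
    have h1 := hv (Ideal.Quotient.mk I (X ^ (q.natDegree - 1 - r.natDegree)))
    rw [hB, ← map_mul, hl] at h1
    have h2 : (r * X ^ (q.natDegree - 1 - r.natDegree)) %ₘ q
        = r * X ^ (q.natDegree - 1 - r.natDegree) := by
      rw [modByMonic_eq_self_iff hq]
      apply degree_lt_degree
      rw [natDegree_mul_X_pow _ hr0]
      omega
    rw [h2, coeff_mul_X_pow', if_pos (by omega)] at h1
    have h3 : q.natDegree - 1 - (q.natDegree - 1 - r.natDegree) = r.natDegree := by omega
    rw [h3] at h1
    exact hr0 (leadingCoeff_eq_zero.mp h1)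

open Polynomial in
theorem hasForm_cyclic {F : Type*} [Field F] (q : F[X]) (hq : q ≠ 0) :
    HasForm F (F[X] ⧸ (Submodule.span F[X] {q})) := by
  have hu : IsUnit (C q.leadingCoeff⁻¹) :=
    Polynomial.isUnit_C.mpr (IsUnit.mk0 _ (inv_ne_zero (leadingCoeff_ne_zero.mpr hq)))
  have h : (Submodule.span F[X] {q}) = (Ideal.span {q * C q.leadingCoeff⁻¹} : Ideal F[X]) :=
    (Ideal.span_singleton_mul_right_unit hu q).symm
  rw [h]
  exact hasForm_cyclic_monic _ (Polynomial.monic_mul_leadingCoeff_inv hq)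

open Polynomial in
theorem hasForm_pi {F ι : Type*} [Field F] [Fintype ι] (M : ι → Type*)
    [∀ i, AddCommGroup (M i)] [∀ i, Module F (M i)] [∀ i, Module F[X] (M i)]
    (h : ∀ i, HasForm F (M i)) : HasForm F (∀ i, M i) := by
  classical
  choose B h1 h2 h3 using h
  let C : (∀ i, M i) →ₗ[F] (∀ i, M i) →ₗ[F] F :=
    ∑ i, (B i).compl₁₂ (LinearMap.proj i) (LinearMap.proj i)
  have hC : ∀ v w, C v w = ∑ i, B i (v i) (w i) := by
    intro v w
    simp [C, LinearMap.sum_apply]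
  refine ⟨C, ?_, ?_, ?_⟩
  · intro v w
    rw [hC, hC]
    exact Finset.sum_congr rfl fun i _ => h1 i _ _
  · intro v w
    rw [hC, hC]
    exact Finset.sum_congr rfl fun i _ => h2 i _ _
  · intro v hv
    funext i
    apply h3 i
    intro w
    have := hv (Pi.single i w)
    rw [hC, Finset.sum_eq_single i] at this
    · simpa using this
    · intro j _ hj
      rw [Pi.single_eq_of_ne hj, map_zero]
    · simp

open Polynomial in
theorem HasForm.of_equiv {F M N : Type*} [Field F] [AddCommGroup M] [Module F M] [Module F[X] M]
    [AddCommGroup N] [Module F N] [Module F[X] N] [IsScalarTower F F[X] M] [IsScalarTower F F[X] N]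
    (e : M ≃ₗ[F[X]] N) (h : HasForm F N) : HasForm F M := by
  obtain ⟨B, h1, h2, h3⟩ := h
  let f : M →ₗ[F] N := (e : M →ₗ[F[X]] N).restrictScalars F
  have hf : ∀ m, f m = e m := fun _ => rfl
  refine ⟨B.compl₁₂ f f, ?_, ?_, ?_⟩
  · intro v w
    simp [LinearMap.compl₁₂_apply, h1 (f v)]
  · intro v w
    simp only [LinearMap.compl₁₂_apply, hf, map_smul, h2]
  · intro v hv
    apply e.injective
    rw [map_zero]
    apply h3
    intro w
    have := hv (e.symm w)
    simpa [hf] using this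

open Polynomial in
theorem exists_form {F V : Type*} [Field F] [AddCommGroup V] [Module F V]
    [FiniteDimensional F V] (g : V →ₗ[F] V) :
    ∃ B : V →ₗ[F] V →ₗ[F] F, (∀ v w, B v w = B w v) ∧
    (∀ v w, B (g v) w = B v (g w)) ∧ (∀ v, (∀ w, B v w = 0) → v = 0) := by
  classical
  have hF : HasForm F (Module.AEval' g) := by
    have ht : Module.IsTorsion F[X] (Module.AEval' g) :=
      Module.AEval.isTorsion_of_finiteDimensional F V g
    obtain ⟨ι, _, p, hp, e, ⟨φ⟩⟩ := Module.equiv_directSum_of_isTorsion ht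
    refine HasForm.of_equiv (φ.trans (DirectSum.linearEquivFunOnFintype F[X] ι _)) ?_
    apply hasForm_pi
    intro i
    exact hasForm_cyclic _ (pow_ne_zero _ (hp i).ne_zero)
  obtain ⟨B, h1, h2, h3⟩ := hF
  let o : V ≃ₗ[F] Module.AEval' g := Module.AEval'.of g
  refine ⟨B.compl₁₂ o.toLinearMap o.toLinearMap, ?_, ?_, ?_⟩
  · intro v w
    simp [LinearMap.compl₁₂_apply, h1 (o v)]
  · intro v w
    have := h2 (o v) (o w)
    simp only [o, Module.AEval'.X_smul_of] at this
    exact this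
  · intro v hv
    apply o.injective
    rw [map_zero]
    apply h3
    intro w
    have := hv (o.symm w)
    simpa using this

abbrev Gr (F V : Type*) [Field F] [AddCommGroup V] [Module F V] (m : ℕ) :=
  {W : Submodule F V // Module.finrank F W = m}

theorem fixed_le {F V : Type*} [Field F] [Finite F] [AddCommGroup V] [Module F V]
    [FiniteDimensional F V] (g : V ≃ₗ[F] V) (n k : ℕ) (hn : Module.finrank F V = n) :
    Nat.card {W : Gr F V k // Submodule.map (g : V →ₗ[F] V) W.1 = W.1} ≤
    Nat.card {W : Gr F V (n - k) // Submodule.map (g : V →ₗ[F] V) W.1 = W.1} := by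
  have : Finite V := Module.finite_of_finite F
  obtain ⟨B, h1, h2, h3⟩ := exists_form (g : V →ₗ[F] V)
  have hr : LinearMap.BilinForm.IsRefl B := fun v w h => by rw [h1]; exact h
  have hnd : LinearMap.BilinForm.Nondegenerate B :=
    ⟨h3, fun v hv => h3 v fun w => by rw [h1]; exact hv w⟩
  let f : {W : Gr F V k // Submodule.map (g : V →ₗ[F] V) W.1 = W.1} →
    {W : Gr F V (n - k) // Submodule.map (g : V →ₗ[F] V) W.1 = W.1} := fun W =>
    ⟨⟨LinearMap.BilinForm.orthogonal B W.1.1, by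
      rw [LinearMap.BilinForm.finrank_orthogonal hnd, hn, W.1.2]⟩, by
      apply Submodule.eq_of_le_of_finrank_eq
      · rintro _ ⟨w, hw, rfl⟩
        intro v hv
        have hgv : g v ∈ W.1.1 := by
          rw [← W.2]; exact ⟨v, hv, rfl⟩
        have := hw (g v) hgv
        change B v (g w) = 0
        rw [← LinearEquiv.coe_coe, ← h2]
        exact this
      · exact LinearEquiv.finrank_map_eq g _⟩
  apply Nat.card_le_card_of_injective f
  intro W W' h
  have h' : LinearMap.BilinForm.orthogonal B W.1.1 = LinearMap.BilinForm.orthogonal B W'.1.1 :=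
    congrArg (fun z => z.1.1) h
  apply Subtype.ext
  apply Subtype.ext
  rw [← LinearMap.BilinForm.orthogonal_orthogonal hnd hr W.1.1, h',
    LinearMap.BilinForm.orthogonal_orthogonal hnd hr]

@[reducible]
def grAct {F V : Type*} [Field F] [AddCommGroup V] [Module F V]
    (H : Subgroup (V ≃ₗ[F] V)) (m : ℕ) : MulAction H (Gr F V m) where
  smul g W := ⟨Submodule.map (g.1 : V →ₗ[F] V) W.1, (LinearEquiv.finrank_map_eq g.1 _).trans W.2⟩
  one_smul W := Subtype.ext (Submodule.map_id _)
  mul_smul g h W := Subtype.ext (Submodule.map_comp (h.1 : V →ₗ[F] V) (g.1 : V →ₗ[F] V) W.1)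

theorem burnside {F V G : Type*} [Field F] [Finite F] [AddCommGroup V] [Module F V]
    [FiniteDimensional F V] [Group G] (ρ : G →* (V ≃ₗ[F] V)) (m : ℕ) [Fintype ρ.range] :
    ∑ g : ρ.range, Nat.card {W : Gr F V m // Submodule.map (g.1 : V →ₗ[F] V) W.1 = W.1}
      = grassOrbitCount F V G ρ m * Fintype.card ρ.range := by
  classical
  have : Finite V := Module.finite_of_finite F
  let _ : MulAction ρ.range (Gr F V m) := grAct ρ.range m
  let _ : Fintype (Gr F V m) := Fintype.ofFinite _
  let _ : Fintype (Quotient (MulAction.orbitRel ρ.range (Gr F V m))) := Fintype.ofFinite _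
  have hb := MulAction.sum_card_fixedBy_eq_card_orbits_mul_card_group ρ.range (Gr F V m)
  have hc : grassOrbitCount F V G ρ m
      = Fintype.card (Quotient (MulAction.orbitRel ρ.range (Gr F V m))) := by
    rw [← Nat.card_eq_fintype_card]
    have ho : ∀ W₀ : Gr F V m, {W : Gr F V m | ∃ g : G,
        (W : Submodule F V) = Submodule.map ((ρ g) : V →ₗ[F] V) (W₀ : Submodule F V)}
        = MulAction.orbit ρ.range W₀ := by
      intro W₀
      ext W
      constructor
      · rintro ⟨g, hg⟩
        exact ⟨⟨ρ g, g, rfl⟩, Subtype.ext hg.symm⟩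
      · rintro ⟨⟨_, g, rfl⟩, hg⟩
        exact ⟨g, (congrArg Subtype.val hg).symm⟩
    symm
    let f : Quotient (MulAction.orbitRel ρ.range (Gr F V m)) →
        {s : Set (Gr F V m) // ∃ W₀ : Gr F V m, s = {W : Gr F V m | ∃ g : G,
        (W : Submodule F V) = Submodule.map ((ρ g) : V →ₗ[F] V) (W₀ : Submodule F V)}} :=
      Quotient.lift (fun W₀ => ⟨MulAction.orbit ρ.range W₀, W₀, (ho W₀).symm⟩) (by
        intro a b hab
        exact Subtype.ext (MulAction.orbit_eq_iff.mpr hab))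
    apply Nat.card_eq_of_bijective f
    constructor
    · intro a b
      induction a using Quotient.inductionOn
      induction b using Quotient.inductionOn
      intro h
      exact Quotient.sound (MulAction.orbit_eq_iff.mp (congrArg Subtype.val h))
    · rintro ⟨_, W₀, rfl⟩
      exact ⟨Quotient.mk _ W₀, Subtype.ext (ho W₀).symm⟩
  rw [hc, ← hb]
  refine Finset.sum_congr rfl fun g _ => ?_
  rw [← Nat.card_eq_fintype_card]
  exact Nat.card_congr (Equiv.subtypeEquivRight fun W =>
    ⟨fun h => Subtype.ext h, fun h => congrArg Subtype.val h⟩)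


theorem stmt3 {F V G : Type*} [Field F] [Fintype F] [AddCommGroup V] [Module F V]
    [FiniteDimensional F V] [Group G] (ρ : G →* (V ≃ₗ[F] V))
    (n k : ℕ) (hn : Module.finrank F V = n)
    (hk1 : 1 ≤ k) (hk2 : k ≤ n - 1) :
    grassOrbitCount F V G ρ k = grassOrbitCount F V G ρ (n - k) := by
  have : Finite V := Module.finite_of_finite F
  have : Finite (V ≃ₗ[F] V) := Finite.of_injective (fun e => (e : V → V)) DFunLike.coe_injective
  let _ : Fintype ρ.range := Fintype.ofFinite _
  have e1 := burnside ρ k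
  have e2 := burnside ρ (n - k)
  have hpos : 0 < Fintype.card ρ.range := Fintype.card_pos
  apply Nat.eq_of_mul_eq_mul_right hpos
  rw [← e1, ← e2]
  refine Finset.sum_congr rfl fun g _ => le_antisymm (fixed_le g.1 n k hn) ?_
  have h := fixed_le g.1 n (n - k) hn
  rwa [show n - (n - k) = k by omega] at h
end

section
/- Let V be an n-dimensional vector space over a finite field F_q and let G be a group acting linearly on V. Let (a_1,...,a_r) be a composition of n (a tuple of nonnegative integers summing to n) and σ a permutation of {1,...,r}. Then the number of G-orbits on the flag variety Fl_{(a_1,...,a_r)}(V) equals the number of G-orbits on Fl_{(a_{σ(1)},...,a_{σ(r)})}(V). -/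
/-- `f` is a flag of type `(a 0, ..., a (r-1))` in `V`: a chain
`⊥ = V₀ ⊆ V₁ ⊆ ... ⊆ V_r = V` with `dim (V_i / V_{i-1}) = a i`. -/
def IsFlagOfType {F V : Type*} [Field F] [AddCommGroup V] [Module F V] {r : ℕ}
    (a : Fin r → ℕ) (f : Fin (r + 1) → Submodule F V) : Prop :=
  Monotone f ∧ f 0 = ⊥ ∧ f (Fin.last r) = ⊤ ∧
    ∀ i : Fin r, Module.finrank F (f i.succ) = Module.finrank F (f i.castSucc) + a i

/-- The number of orbits of `G`, acting linearly on `V` through `ρ`, on the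
flag variety of flags of type `a` in `V`, counted as the number of orbit sets. -/
noncomputable def flagOrbitCount (F V G : Type*) [Field F] [AddCommGroup V] [Module F V]
    [Group G] (ρ : G →* (V ≃ₗ[F] V)) {r : ℕ} (a : Fin r → ℕ) : ℕ :=
  Nat.card {s : Set {f : Fin (r + 1) → Submodule F V // IsFlagOfType a f} //
    ∃ f₀ : {f : Fin (r + 1) → Submodule F V // IsFlagOfType a f},
      s = {f : {f : Fin (r + 1) → Submodule F V // IsFlagOfType a f} | ∃ g : G,
        (f : Fin (r + 1) → Submodule F V) =
          fun i => Submodule.map ((ρ g) : V →ₗ[F] V) (f₀.1 i)}}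

open Polynomial in
theorem cyc_monic {F : Type*} [Field F] (g : F[X]) (hg : g.Monic) :
    ∃ l : (F[X] ⧸ Submodule.span F[X] {g}) →ₗ[F] F,
      ∀ x, (∀ y, l (x * y) = 0) → x = 0 := by
  change ∃ l : AdjoinRoot g →ₗ[F] F, ∀ x : AdjoinRoot g, (∀ y : AdjoinRoot g, l (x * y) = 0) → x = 0
  refine ⟨(Polynomial.lcoeff F (g.natDegree - 1)).comp (AdjoinRoot.modByMonicHom hg), ?_⟩
  intro x hx
  obtain ⟨p0, rfl⟩ := AdjoinRoot.mk_surjective x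
  by_contra hne
  set p := p0 %ₘ g with hp
  have hpp : AdjoinRoot.mk g p0 = AdjoinRoot.mk g p := by
    have := AdjoinRoot.mk_leftInverse hg (AdjoinRoot.mk g p0)
    rw [AdjoinRoot.modByMonicHom_mk] at this
    exact this.symm
  rw [hpp] at hx hne
  have hp0 : p ≠ 0 := by
    intro h; apply hne; rw [h, map_zero]
  have hdeg : p.degree < g.degree := Polynomial.degree_modByMonic_lt _ hg
  have hnd : p.natDegree < g.natDegree := Polynomial.natDegree_lt_natDegree hp0 hdeg
  have h1 := hx (AdjoinRoot.mk g (X ^ (g.natDegree - 1 - p.natDegree)))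
  rw [← map_mul] at h1
  simp only [LinearMap.comp_apply, AdjoinRoot.modByMonicHom_mk, Polynomial.lcoeff_apply] at h1
  rw [(Polynomial.modByMonic_eq_self_iff hg).2] at h1
  · have h2 : g.natDegree - 1 = p.natDegree + (g.natDegree - 1 - p.natDegree) := by omega
    rw [h2, Nat.add_sub_cancel_left, Polynomial.coeff_mul_X_pow] at h1
    exact hp0 (Polynomial.leadingCoeff_eq_zero.1 h1)
  · apply Polynomial.degree_lt_degree
    rw [Polynomial.natDegree_mul_X_pow _ hp0]
    omega

open Polynomial in
theorem cyc_form {F : Type*} [Field F] (f : F[X]) (hf : f ≠ 0) :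
    ∃ l : (F[X] ⧸ Submodule.span F[X] {f}) →ₗ[F] F,
      ∀ x, (∀ y, l (x * y) = 0) → x = 0 := by
  have h : Submodule.span F[X] {f} = Submodule.span F[X] {f * C f.leadingCoeff⁻¹} := by
    symm
    apply Ideal.span_singleton_mul_right_unit
    rw [Polynomial.isUnit_C]
    simpa using hf
  rw [h]
  exact cyc_monic _ (Polynomial.monic_mul_leadingCoeff_inv hf)

open Polynomial in
theorem tors_of_fin {F M : Type*} [Field F] [AddCommGroup M] [Module F M]
    [Module F[X] M] [IsScalarTower F F[X] M] [FiniteDimensional F M] :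
    Module.IsTorsion F[X] M := by
  intro x
  let φ : F[X] →ₗ[F] M := (LinearMap.toSpanSingleton F[X] M x).restrictScalars F
  have hφ : ¬ Function.Injective φ := by
    intro hi
    have := Module.Finite.of_injective φ hi
    exact Polynomial.not_finite this
  rw [← LinearMap.ker_eq_bot, Submodule.eq_bot_iff] at hφ
  push Not at hφ
  obtain ⟨p, hp, hp0⟩ := hφ
  exact ⟨⟨p, mem_nonZeroDivisors_of_ne_zero hp0⟩, hp⟩

open Polynomial in
theorem exists_form_s7 {F : Type*} {M : Type*} [Field F] [AddCommGroup M] [Module F M]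
    [Module F[X] M] [IsScalarTower F F[X] M] [FiniteDimensional F M] :
    ∃ B : LinearMap.BilinForm F M, B.IsSymm ∧ B.Nondegenerate ∧
      ∀ (p : F[X]) (x y : M), B (p • x) y = B x (p • y) := by
  classical
  have : Module.Finite F[X] M := Module.Finite.of_restrictScalars_finite F F[X] M
  obtain ⟨ι, _, p, hp, e, ⟨E⟩⟩ := Module.equiv_directSum_of_isTorsion (tors_of_fin (F := F) (M := M))
  choose l hl using fun i => cyc_form (p i ^ e i) (pow_ne_zero _ (hp i).ne_zero)
  let π : ∀ i, M →ₗ[F[X]] (F[X] ⧸ Submodule.span F[X] {p i ^ e i}) := fun i =>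
    (DirectSum.component F[X] ι _ i).comp E.toLinearMap
  let B : LinearMap.BilinForm F M := ∑ i,
    ((LinearMap.mul F (F[X] ⧸ Submodule.span F[X] {p i ^ e i})).compr₂ (l i)).compl₁₂
      ((π i).restrictScalars F) ((π i).restrictScalars F)
  have hB : ∀ x y, B x y = ∑ i, l i (π i x * π i y) := by
    intro x y
    simp [B, LinearMap.sum_apply]
  have hs : B.IsSymm := ⟨fun x y => by simp only [hB, mul_comm]⟩
  refine ⟨B, hs, ?_, ?_⟩
  · refine (LinearMap.IsRefl.nondegenerate_iff_separatingLeft hs.isRefl).2 ?_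
    intro x hx
    apply E.injective
    rw [map_zero]
    refine DirectSum.ext_component F[X] fun i => ?_
    rw [map_zero]
    apply hl i
    intro y
    have h := hx (E.symm (DirectSum.lof F[X] ι _ i y))
    rw [hB, Finset.sum_eq_single i] at h
    · simpa [π] using h
    · intro j _ hj
      have : π j (E.symm (DirectSum.lof F[X] ι _ i y)) = 0 := by
        simp [π, DirectSum.component.of, hj.symm]
      rw [this, mul_zero, map_zero]
    · simp
  · intro q x y
    simp only [hB, map_smul, smul_mul_assoc, mul_smul_comm]

open Polynomial in
theorem exists_perp {F : Type*} {M : Type*} [Field F] [AddCommGroup M] [Module F M]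
    [Module F[X] M] [IsScalarTower F F[X] M] [FiniteDimensional F M] :
    ∃ Φ : Submodule F[X] M → Submodule F[X] M, ∀ W, Φ (Φ W) = W ∧
      Module.finrank F (Φ W) + Module.finrank F W = Module.finrank F M := by
  obtain ⟨B, hs, hn, ha⟩ := exists_form_s7 (F := F) (M := M)
  let Φ : Submodule F[X] M → Submodule F[X] M := fun W =>
    { B.orthogonal (W.restrictScalars F) with
      smul_mem' := by
        intro c x hx w hw
        have := hx (c • w) (W.smul_mem c hw)
        change B w (c • x) = 0
        rw [← ha]; exact this }
  have hΦ : ∀ W, (Φ W).restrictScalars F = B.orthogonal (W.restrictScalars F) := fun W => rfl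
  refine ⟨Φ, fun W => ⟨?_, ?_⟩⟩
  · apply Submodule.restrictScalars_injective F
    rw [hΦ, hΦ, LinearMap.BilinForm.orthogonal_orthogonal hn hs.isRefl]
  · have h1 := LinearMap.BilinForm.finrank_orthogonal hn (W.restrictScalars F)
    rw [← hΦ] at h1
    have h2 := Submodule.finrank_le (W.restrictScalars F)
    change Module.finrank F (Φ W) = _ - Module.finrank F W at h1
    change Module.finrank F W ≤ _ at h2
    omega

theorem finrank_comap_surj {F X Y : Type*} [Field F] [AddCommGroup X] [Module F X]
    [AddCommGroup Y] [Module F Y] [FiniteDimensional F X] (g : X →ₗ[F] Y)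
    (hg : Function.Surjective g) (N : Submodule F Y) :
    Module.finrank F (N.comap g) = Module.finrank F N + Module.finrank F (LinearMap.ker g) := by
  have h := LinearMap.finrank_range_add_finrank_ker (g.domRestrict (N.comap g))
  rw [LinearMap.range_domRestrict, Submodule.map_comap_eq_of_surjective hg,
    LinearMap.ker_domRestrict] at h
  rw [← h]
  congr 1
  refine LinearEquiv.finrank_eq (Submodule.comapSubtypeEquivOfLe ?_)
  intro x hx
  rw [LinearMap.mem_ker] at hx
  simp [hx]

open Polynomial in
theorem finrank_comap_surj' {F X' Y : Type*} [Field F] [AddCommGroup X'] [Module F X']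
    [Module F[X] X'] [IsScalarTower F F[X] X'] 
    [AddCommGroup Y] [Module F[X] Y] [Module F Y] [IsScalarTower F F[X] Y] [FiniteDimensional F X']
    (g : X' →ₗ[F[X]] Y)
    (hg : Function.Surjective g) (N : Submodule F[X] Y) :
    Module.finrank F (N.comap g) = Module.finrank F N + Module.finrank F (LinearMap.ker g) :=
  finrank_comap_surj (g.restrictScalars F) hg (N.restrictScalars F)

open Polynomial in
theorem finrank_surj' {F X' Y : Type*} [Field F] [AddCommGroup X'] [Module F X']
    [Module F[X] X'] [IsScalarTower F F[X] X'] 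
    [AddCommGroup Y] [Module F[X] Y] [Module F Y] [IsScalarTower F F[X] Y] [FiniteDimensional F X']
    (g : X' →ₗ[F[X]] Y)
    (hg : Function.Surjective g) :
    Module.finrank F Y + Module.finrank F (LinearMap.ker g) = Module.finrank F X' := by
  have e2 := LinearMap.finrank_range_add_finrank_ker (g.restrictScalars F)
  have e3 : LinearMap.range (g.restrictScalars F) = ⊤ := LinearMap.range_eq_top.2 hg
  rw [e3, finrank_top] at e2
  exact e2

open Polynomial in
theorem interval_aux {F M D Q : Type*} [Field F] [AddCommGroup M] [Module F M]
    [Module F[X] M] [IsScalarTower F F[X] M] [FiniteDimensional F M]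
    [AddCommGroup D] [Module F D] [Module F[X] D] [IsScalarTower F F[X] D] [FiniteDimensional F D]
    [AddCommGroup Q] [Module F Q] [Module F[X] Q] [IsScalarTower F F[X] Q]
    (ι : D →ₗ[F[X]] M) (π : D →ₗ[F[X]] Q) (hι : Function.Injective ι)
    (hπ : Function.Surjective π)
    (A C : Submodule F[X] M) (hAC : A ≤ C) (hC : LinearMap.range ι = C)
    (hk : LinearMap.ker π = A.comap ι) :
    ∃ Φ : Submodule F[X] M → Submodule F[X] M, ∀ W, A ≤ W → W ≤ C →
      A ≤ Φ W ∧ Φ W ≤ C ∧ Φ (Φ W) = W ∧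
      Module.finrank F (Φ W) + Module.finrank F W = Module.finrank F A + Module.finrank F C := by
  have : FiniteDimensional F Q := Module.Finite.of_surjective (π.restrictScalars F) hπ
  obtain ⟨Φ, hΦ⟩ := exists_perp (F := F) (M := Q)
  obtain ⟨up, hup⟩ : ∃ up : Submodule F[X] Q → Submodule F[X] M,
    ∀ N, up N = (N.comap π).map ι := ⟨_, fun _ => rfl⟩
  obtain ⟨dn, hdn⟩ : ∃ dn : Submodule F[X] M → Submodule F[X] Q,
    ∀ W, dn W = (W.comap ι).map π := ⟨_, fun _ => rfl⟩
  have h1 : ∀ N, dn (up N) = N := by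
    intro N
    rw [hdn, hup, Submodule.comap_map_eq_of_injective hι, Submodule.map_comap_eq_of_surjective hπ]
  have h2 : ∀ W, A ≤ W → W ≤ C → up (dn W) = W := by
    intro W hA hWC
    rw [hdn, hup, Submodule.comap_map_eq, hk, sup_eq_left.2 (Submodule.comap_mono hA),
      Submodule.map_comap_eq, hC, inf_eq_right.2 hWC]
  have h3 : ∀ N, A ≤ up N := by
    intro N x hx
    have hx' := hAC hx
    rw [← hC] at hx'
    obtain ⟨y, rfl⟩ := hx'
    rw [hup]
    refine Submodule.mem_map_of_mem ?_
    have : y ∈ LinearMap.ker π := by rw [hk]; exact hx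
    rw [LinearMap.mem_ker] at this
    rw [Submodule.mem_comap, this]
    exact zero_mem _
  have h4 : ∀ N, up N ≤ C := by
    intro N
    rw [hup, ← hC]
    exact LinearMap.map_le_range
  have e0 : ∀ P : Submodule F[X] D, Module.finrank F (P.map ι) = Module.finrank F P := fun P =>
    (LinearEquiv.finrank_eq ((Submodule.equivMapOfInjective ι hι P).restrictScalars F)).symm
  have hA' : Module.finrank F (LinearMap.ker π) = Module.finrank F A := by
    have := e0 (LinearMap.ker π)
    rw [← this, hk, Submodule.map_comap_eq, hC, inf_eq_right.2 hAC]
  have hC' : Module.finrank F D = Module.finrank F C := by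
    rw [← hC]
    exact LinearEquiv.finrank_eq ((LinearEquiv.ofInjective ι hι).restrictScalars F)
  have h5 : ∀ N, Module.finrank F (up N) = Module.finrank F N + Module.finrank F A := by
    intro N
    rw [hup, e0, finrank_comap_surj' (F := F) π hπ N, hA']
  have h6 := finrank_surj' (F := F) π hπ
  refine ⟨fun W => up (Φ (dn W)), fun W hA hWC => ⟨h3 _, h4 _, ?_, ?_⟩⟩
  · simp only [h1, (hΦ _).1, h2 W hA hWC]
  · have e1 := (hΦ (dn W)).2
    have e2 := h5 (Φ (dn W))
    have e3 := h5 (dn W)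
    rw [h2 W hA hWC] at e3
    dsimp only
    omega

open Polynomial in
theorem exists_perp_interval {F : Type*} {M : Type*} [Field F] [AddCommGroup M] [Module F M]
    [Module F[X] M] [IsScalarTower F F[X] M] [FiniteDimensional F M]
    (A C : Submodule F[X] M) (hAC : A ≤ C) :
    ∃ Φ : Submodule F[X] M → Submodule F[X] M, ∀ W, A ≤ W → W ≤ C →
      A ≤ Φ W ∧ Φ W ≤ C ∧ Φ (Φ W) = W ∧
      Module.finrank F (Φ W) + Module.finrank F W = Module.finrank F A + Module.finrank F C := by
  have : FiniteDimensional F C := inferInstanceAs (FiniteDimensional F (C.restrictScalars F))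
  exact interval_aux C.subtype (A.comap C.subtype).mkQ C.injective_subtype
    (Submodule.mkQ_surjective _) A C hAC (Submodule.range_subtype _) (Submodule.ker_mkQ _)

open Polynomial in
theorem exists_perp_inv {F : Type*} {V : Type*} [Field F] [AddCommGroup V] [Module F V]
    [FiniteDimensional F V] (T : V →ₗ[F] V)
    (A C : Submodule F V) (hA : A.map T ≤ A) (hC : C.map T ≤ C) (hAC : A ≤ C) :
    ∃ Φ : Submodule F V → Submodule F V, ∀ W, W.map T ≤ W → A ≤ W → W ≤ C →
      (Φ W).map T ≤ Φ W ∧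
      A ≤ Φ W ∧ Φ W ≤ C ∧ Φ (Φ W) = W ∧
      Module.finrank F (Φ W) + Module.finrank F W = Module.finrank F A + Module.finrank F C := by
  classical
  let _ : Module F[X] V := Module.compHom V (aeval T : F[X] →ₐ[F] Module.End F V).toRingHom
  have hsm : ∀ (p : F[X]) (v : V), p • v = aeval T p v := fun _ _ => rfl
  have : IsScalarTower F F[X] V := ⟨fun c p v => by simp [hsm]⟩
  have hlift : ∀ W : Submodule F V, W.map T ≤ W →
      ∃ W' : Submodule F[X] V, W'.restrictScalars F = W := by
    intro W hW
    refine ⟨{ W with smul_mem' := ?_ }, rfl⟩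
    intro p v hv
    change aeval T p v ∈ W
    have hT : ∀ v ∈ W, T v ∈ W := fun v hv => hW (Submodule.mem_map_of_mem hv)
    induction p using Polynomial.induction_on' with
    | add p q hp hq => rw [map_add]; exact W.add_mem hp hq
    | monomial n c =>
      rw [aeval_monomial]
      simp only [Module.End.mul_apply, Module.algebraMap_end_apply]
      apply W.smul_mem
      induction n with
      | zero => simpa using hv
      | succ n ih => rw [pow_succ', Module.End.mul_apply]; exact hT _ ih
  have hinv : ∀ W' : Submodule F[X] V, (W'.restrictScalars F).map T ≤ W'.restrictScalars F := by
    rintro W' _ ⟨v, hv, rfl⟩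
    have := W'.smul_mem X hv
    rw [hsm, aeval_X] at this
    exact this
  obtain ⟨A', rfl⟩ := hlift A hA
  obtain ⟨C', rfl⟩ := hlift C hC
  obtain ⟨Φ, hΦ⟩ := exists_perp_interval (F := F) A' C' hAC
  choose! L hL using hlift
  have hL' : ∀ W', L (Submodule.restrictScalars F W') = W' := fun W' =>
    Submodule.restrictScalars_injective F _ _ (hL _ (hinv W'))
  obtain ⟨Ψ, hΨ⟩ : ∃ Ψ : Submodule F V → Submodule F V,
    ∀ W' : Submodule F[X] V, Ψ (W'.restrictScalars F) = (Φ W').restrictScalars F :=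
    ⟨fun W => (Φ (L W)).restrictScalars F, fun W' => by simp only [hL']⟩
  refine ⟨Ψ, fun W hW hAW hWC => ?_⟩
  obtain ⟨W', rfl⟩ : ∃ W' : Submodule F[X] V, W'.restrictScalars F = W := ⟨L W, hL W hW⟩
  obtain ⟨h1, h2, h3, h4⟩ := hΦ W' hAW hWC
  rw [hΨ, hΨ, h3]
  exact ⟨hinv _, h1, h2, rfl, h4⟩

def FixFlag {F V : Type*} [Field F] [AddCommGroup V] [Module F V] {r : ℕ}
    (T : V →ₗ[F] V) (a : Fin r → ℕ) (f : Fin (r + 1) → Submodule F V) : Prop :=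
  IsFlagOfType a f ∧ ∀ i, (f i).map T ≤ f i

theorem fix_swap {F V : Type*} [Field F] [AddCommGroup V] [Module F V]
    [FiniteDimensional F V] (T : V →ₗ[F] V) {m : ℕ} (a : Fin (m + 1) → ℕ) (i : Fin m) :
    Nat.card {f // FixFlag T a f} =
      Nat.card {f // FixFlag T (a ∘ Equiv.swap i.castSucc i.succ) f} := by
  classical
  choose! Φ hΦ using exists_perp_inv T
  let up : (Fin (m + 2) → Submodule F V) → (Fin (m + 2) → Submodule F V) := fun f =>
    Function.update f i.succ.castSucc
      (Φ (f i.castSucc.castSucc) (f i.succ.succ) (f i.succ.castSucc))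
  have hlo : i.castSucc.castSucc ≠ i.succ.castSucc := by
    simp [Fin.ext_iff]
  have hhi : i.succ.succ ≠ i.succ.castSucc := by
    simp [Fin.ext_iff]
  have key : ∀ (a : Fin (m + 1) → ℕ) f, FixFlag T a f →
      FixFlag T (a ∘ Equiv.swap i.castSucc i.succ) (up f) ∧ up (up f) = f := by
    rintro a f ⟨⟨hm, h0, hl, hd⟩, hT⟩
    have hle1 : f i.castSucc.castSucc ≤ f i.succ.castSucc := hm (by simp [Fin.le_def])
    have hle2 : f i.succ.castSucc ≤ f i.succ.succ := hm (by simp [Fin.le_def])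
    obtain ⟨k1, k2, k3, k4, k5⟩ := hΦ _ _ (hT i.castSucc.castSucc) (hT i.succ.succ)
      (hle1.trans hle2) _ (hT i.succ.castSucc) hle1 hle2
    have umid : up f i.succ.castSucc =
      Φ (f i.castSucc.castSucc) (f i.succ.succ) (f i.succ.castSucc) := Function.update_self ..
    have uoth : ∀ k, k ≠ i.succ.castSucc → up f k = f k := fun k hk =>
      Function.update_of_ne hk ..
    have hs : i.castSucc.succ = i.succ.castSucc := rfl
    have d1 := hd i.castSucc
    have d2 := hd i.succ
    rw [hs] at d1
    refine ⟨⟨⟨?_, ?_, ?_, ?_⟩, ?_⟩, ?_⟩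
    · rw [Fin.monotone_iff_le_succ]
      intro k
      by_cases hk1 : k = i.castSucc
      · subst hk1
        rw [hs, umid, uoth _ hlo]; exact k2
      by_cases hk2 : k = i.succ
      · subst hk2
        rw [umid, uoth _ hhi]; exact k3
      rw [uoth, uoth]
      · exact hm (by simp [Fin.le_def])
      · intro h; exact hk1 (Fin.succ_injective _ (h.trans hs.symm))
      · intro h; exact hk2 (Fin.castSucc_injective _ h)
    · rw [uoth _ (by simp [Fin.ext_iff]), h0]
    · rw [uoth _ (by simp [Fin.ext_iff]; omega), hl]
    · intro k
      by_cases hk1 : k = i.castSucc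
      · subst hk1
        rw [hs, umid, uoth _ hlo]
        simp only [Function.comp_apply, Equiv.swap_apply_left]
        omega
      by_cases hk2 : k = i.succ
      · subst hk2
        rw [umid, uoth _ hhi]
        simp only [Function.comp_apply, Equiv.swap_apply_right]
        omega
      rw [uoth, uoth]
      · simp only [Function.comp_apply, Equiv.swap_apply_of_ne_of_ne hk1 hk2]
        exact hd k
      · intro h; exact hk2 (Fin.castSucc_injective _ h)
      · intro h; exact hk1 (Fin.succ_injective _ (h.trans hs.symm))
    · intro k
      by_cases hk : k = i.succ.castSucc
      · subst hk; rw [umid]; exact k1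
      · rw [uoth _ hk]; exact hT k
    · funext k
      by_cases hk : k = i.succ.castSucc
      · subst hk
        change Function.update (up f) _ _ _ = _
        rw [Function.update_self, umid, uoth _ hlo, uoth _ hhi, k4]
      · change Function.update (up f) _ _ _ = _
        rw [Function.update_of_ne hk, uoth _ hk]
  have hback : ∀ f, FixFlag T (a ∘ Equiv.swap i.castSucc i.succ) f → FixFlag T a (up f) := by
    intro f hf
    have := (key _ f hf).1
    have e : (a ∘ Equiv.swap i.castSucc i.succ) ∘ Equiv.swap i.castSucc i.succ = a := by
      funext k; simp
    rwa [e] at this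
  exact Nat.card_congr
    { toFun := fun f => ⟨up f.1, (key a f.1 f.2).1⟩
      invFun := fun f => ⟨up f.1, hback f.1 f.2⟩
      left_inv := fun f => Subtype.ext (key a f.1 f.2).2
      right_inv := fun f => Subtype.ext (key _ f.1 f.2).2 }

theorem fix_perm {F V : Type*} [Field F] [AddCommGroup V] [Module F V]
    [FiniteDimensional F V] (T : V →ₗ[F] V) {r : ℕ} (a : Fin r → ℕ) (σ : Equiv.Perm (Fin r)) :
    Nat.card {f // FixFlag T a f} = Nat.card {f // FixFlag T (a ∘ σ) f} := by
  cases r with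
  | zero =>
    have : a ∘ σ = a := by funext k; exact k.elim0
    rw [this]
  | succ m =>
    have hσ : σ ∈ Submonoid.closure (Set.range fun i : Fin m ↦ Equiv.swap i.castSucc i.succ) := by
      rw [Equiv.Perm.mclosure_swap_castSucc_succ]; trivial
    induction hσ using Submonoid.closure_induction generalizing a with
    | mem x hx => obtain ⟨i, rfl⟩ := hx; exact fix_swap T a i
    | one => rfl
    | mul x y _ _ hx hy =>
      rw [hx a, hy (a ∘ x)]
      rfl

abbrev FlagT (F V : Type*) [Field F] [AddCommGroup V] [Module F V] {r : ℕ} (a : Fin r → ℕ) :=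
  {f : Fin (r + 1) → Submodule F V // IsFlagOfType a f}

noncomputable def flagAction {F V : Type*} [Field F] [AddCommGroup V] [Module F V]
    (H : Subgroup (V ≃ₗ[F] V)) {r : ℕ} (a : Fin r → ℕ) : MulAction H (FlagT F V a) where
  smul g f := ⟨fun i => Submodule.map (g.1 : V →ₗ[F] V) (f.1 i), by
    obtain ⟨f, hm, h0, hl, hd⟩ := f
    refine ⟨fun i j hij => Submodule.map_mono (hm hij), ?_, ?_, ?_⟩
    · simp [h0]
    · simp [hl]
    · intro i
      have e := fun k => LinearEquiv.finrank_map_eq g.1 (f k)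
      rw [e, e, hd]⟩
  one_smul f := Subtype.ext (funext fun i => Submodule.map_id _)
  mul_smul g h f := Subtype.ext (funext fun i =>
    Submodule.map_comp (h.1 : V →ₗ[F] V) (g.1 : V →ₗ[F] V) (f.1 i))

theorem count_eq {F V G : Type*} [Field F] [AddCommGroup V] [Module F V] [Finite V] [Group G]
    [FiniteDimensional F V] (ρ : G →* (V ≃ₗ[F] V)) {r : ℕ} (a : Fin r → ℕ) [Fintype ρ.range] :
    ∑ g : ρ.range, Nat.card {f // FixFlag (g.1 : V →ₗ[F] V) a f} =
      flagOrbitCount F V G ρ a * Fintype.card ρ.range := by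
  classical
  let _ := flagAction ρ.range a
  have hsm : ∀ (g : ρ.range) (f : FlagT F V a) i,
    (g • f).1 i = Submodule.map (g.1 : V →ₗ[F] V) (f.1 i) := fun _ _ _ => rfl
  have : Finite (Submodule F V) := Finite.of_injective _ SetLike.coe_injective
  have : Finite (FlagT F V a) := inferInstance
  have _ : Fintype (FlagT F V a) := Fintype.ofFinite _
  have _ : Fintype (Quotient (MulAction.orbitRel ρ.range (FlagT F V a))) := Fintype.ofFinite _
  have _ : ∀ g : ρ.range, Fintype (MulAction.fixedBy (FlagT F V a) g) :=
    fun _ => Fintype.ofFinite _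
  have hb := MulAction.sum_card_fixedBy_eq_card_orbits_mul_card_group ρ.range (FlagT F V a)
  have h1 : flagOrbitCount F V G ρ a =
      Fintype.card (Quotient (MulAction.orbitRel ρ.range (FlagT F V a))) := by
    rw [← Nat.card_eq_fintype_card]
    have horb : ∀ f₀ : FlagT F V a, {f : FlagT F V a | ∃ g : G,
        (f : Fin (r + 1) → Submodule F V) =
          fun i => Submodule.map ((ρ g) : V →ₗ[F] V) (f₀.1 i)} = MulAction.orbit ρ.range f₀ := by
      intro f₀
      ext f
      constructor
      · rintro ⟨g, hg⟩
        exact ⟨⟨ρ g, g, rfl⟩, Subtype.ext hg.symm⟩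
      · rintro ⟨⟨_, g, rfl⟩, rfl⟩
        exact ⟨g, rfl⟩
    unfold flagOrbitCount
    symm
    refine Nat.card_congr (Equiv.ofBijective (fun q => ⟨MulAction.orbitRel.Quotient.orbit q, ?_⟩) ⟨?_, ?_⟩)
    · induction q using Quotient.inductionOn with
      | h f₀ => exact ⟨f₀, (horb f₀).symm⟩
    · intro q q' h
      exact MulAction.orbitRel.Quotient.orbit_injective (Subtype.ext_iff.1 h)
    · rintro ⟨_, f₀, rfl⟩
      exact ⟨Quotient.mk _ f₀, Subtype.ext (horb f₀).symm⟩
  rw [h1, ← hb]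
  refine Finset.sum_congr rfl fun g _ => ?_
  rw [← Nat.card_eq_fintype_card]
  have hfix : ∀ W : Submodule F V, W.map (g.1 : V →ₗ[F] V) ≤ W →
      W.map (g.1 : V →ₗ[F] V) = W := fun W hW =>
    Submodule.eq_of_le_of_finrank_eq hW (LinearEquiv.finrank_map_eq g.1 W)
  exact Nat.card_congr
    { toFun := fun f => ⟨⟨f.1, f.2.1⟩, Subtype.ext (funext fun i => hfix _ (f.2.2 i))⟩
      invFun := fun f => ⟨f.1.1, f.1.2, fun i => (congrFun (congrArg Subtype.val f.2) i).le⟩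
      left_inv := fun _ => rfl
      right_inv := fun _ => rfl }

theorem stmt7 {F V G : Type*} [Field F] [Fintype F] [AddCommGroup V] [Module F V]
    [FiniteDimensional F V] [Group G] (ρ : G →* (V ≃ₗ[F] V))
    (n r : ℕ) (hn : Module.finrank F V = n) (a : Fin r → ℕ) (ha : ∑ i, a i = n)
    (σ : Equiv.Perm (Fin r)) :
    flagOrbitCount F V G ρ a = flagOrbitCount F V G ρ (a ∘ σ) := by
  classical
  have : Finite V := Module.finite_of_finite F
  have : Finite (V ≃ₗ[F] V) := Finite.of_injective _ DFunLike.coe_injective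
  have _ : Fintype ρ.range := Fintype.ofFinite _
  have h1 := count_eq ρ a
  have h2 := count_eq ρ (a ∘ σ)
  rw [Finset.sum_congr rfl fun g _ => fix_perm _ a σ, h2] at h1
  exact (Nat.eq_of_mul_eq_mul_right Fintype.card_pos h1).symm
end

section
/- Let V be an n-dimensional vector space over a finite field F_q, let G be a group acting linearly on V, and let (a_1,...,a_r) be a composition of n. Fix i ∈ {1,...,r-1} and nonnegative integers b, c with b + c = a_i + a_{i+1} and bc ≤ a_i·a_{i+1}. Then the number of G-orbits on Fl_{(a_1,...,a_{i-1},b,c,a_{i+2},...,a_r)}(V) is at most the number of G-orbits on Fl_{(a_1,...,a_r)}(V). -/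
open Module

lemma ext_compl {F V V' : Type*} [Field F] [AddCommGroup V] [Module F V] [AddCommGroup V'] [Module F V']
    {p q : Submodule F V} {p' q' : Submodule F V'} (h : IsCompl p q) (h' : IsCompl p' q')
    (e₁ : p ≃ₗ[F] p') (e₂ : q ≃ₗ[F] q') :
    ∃ e : V ≃ₗ[F] V', (∀ x : p, e x = e₁ x) ∧ (∀ x : q, e x = e₂ x) := by
  refine ⟨(Submodule.prodEquivOfIsCompl p q h).symm ≪≫ₗ (e₁.prodCongr e₂) ≪≫ₗ
    Submodule.prodEquivOfIsCompl p' q' h', ?_, ?_⟩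
  · intro x; simp
  · intro x; simp

lemma map_eq_of_ext {F V V' : Type*} [Field F] [AddCommGroup V] [Module F V] [AddCommGroup V'] [Module F V']
    {p : Submodule F V} {p' : Submodule F V'} (e₁ : p ≃ₗ[F] p') (e : V ≃ₗ[F] V')
    (h : ∀ x : p, e x = e₁ x) : p.map (e : V →ₗ[F] V') = p' := by
  ext y
  constructor
  · rintro ⟨x, hx, rfl⟩
    have := h ⟨x, hx⟩
    simp only [LinearEquiv.coe_coe] at *
    rw [this]; exact (e₁ _).2
  · intro hy
    refine ⟨e₁.symm ⟨y, hy⟩, (e₁.symm _).2, ?_⟩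
    have := h (e₁.symm ⟨y, hy⟩)
    simpa using this

lemma exists_equiv_map {F V V' : Type*} [Field F] [AddCommGroup V] [Module F V] [AddCommGroup V'] [Module F V']
    [FiniteDimensional F V] [FiniteDimensional F V'] (hV : finrank F V = finrank F V')
    (p : Submodule F V) (p' : Submodule F V') (hp : finrank F p = finrank F p') :
    ∃ e : V ≃ₗ[F] V', p.map (e : V →ₗ[F] V') = p' := by
  obtain ⟨q, hq⟩ := p.exists_isCompl
  obtain ⟨q', hq'⟩ := p'.exists_isCompl
  have h1 := Submodule.finrank_add_eq_of_isCompl hq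
  have h2 := Submodule.finrank_add_eq_of_isCompl hq'
  obtain ⟨e, he, -⟩ := ext_compl hq hq' (LinearEquiv.ofFinrankEq _ _ hp)
    (LinearEquiv.ofFinrankEq q q' (by omega))
  exact ⟨e, map_eq_of_ext _ _ he⟩

/-- inside subspaces -/
lemma exists_equiv_sub {F V : Type*} [Field F] [AddCommGroup V] [Module F V]
    [FiniteDimensional F V] (T X T' X' : Submodule F V) (hT : T ≤ X) (hT' : T' ≤ X')
    (h : finrank F T = finrank F T') (hX : finrank F X = finrank F X') :
    ∃ e : X ≃ₗ[F] X', ∀ g : V ≃ₗ[F] V, (∀ x : X, g x = e x) → T.map (g : V →ₗ[F] V) = T' := by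
  obtain ⟨e, he⟩ := exists_equiv_map hX (T.submoduleOf X) (T'.submoduleOf X') (by
    rw [(Submodule.submoduleOfEquivOfLe hT).finrank_eq, (Submodule.submoduleOfEquivOfLe hT').finrank_eq, h])
  refine ⟨e, fun g hg => ?_⟩
  have h1 : T = (T.submoduleOf X).map X.subtype := by
    simp [Submodule.submoduleOf, Submodule.map_comap_subtype, hT]
  have h2 : T' = (T'.submoduleOf X').map X'.subtype := by
    simp [Submodule.submoduleOf, Submodule.map_comap_subtype, hT']
  rw [h1, h2, ← he, ← Submodule.map_comp, ← Submodule.map_comp]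
  congr 1
  ext x
  simpa using hg x

lemma finrank_disj {F V : Type*} [Field F] [AddCommGroup V] [Module F V]
    [FiniteDimensional F V] {A B : Submodule F V} (h : Disjoint A B) :
    finrank F (A ⊔ B : Submodule F V) = finrank F A + finrank F B := by
  have := Submodule.finrank_sup_add_finrank_inf_eq A B
  rw [h.eq_bot, finrank_bot] at this
  omega

lemma decomp {F V : Type*} [Field F] [AddCommGroup V] [Module F V]
    [FiniteDimensional F V] (X B : Submodule F V) :
    ∃ B1 D : Submodule F V, B1 ≤ D ∧ IsCompl X D ∧ (B ⊓ X) ⊔ B1 = B ∧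
      finrank F (B ⊓ X : Submodule F V) + finrank F B1 = finrank F B := by
  obtain ⟨E, hE⟩ := (B ⊓ X).exists_isCompl
  obtain ⟨C, hC⟩ := (X ⊔ B).exists_isCompl
  have hsup : (B ⊓ X) ⊔ (B ⊓ E) = B := by
    rw [inf_comm B E, ← sup_inf_assoc_of_le _ inf_le_left, hE.sup_eq_top, top_inf_eq]
  have hdis : Disjoint (B ⊓ X) (B ⊓ E) := hE.disjoint.mono_right inf_le_right
  have hXB : X ⊔ (B ⊓ E) = X ⊔ B := by
    conv_rhs => rw [← hsup, ← sup_assoc, sup_eq_left.2 (inf_le_right : B ⊓ X ≤ X)]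
  have hd2 : Disjoint X (B ⊓ E) := by
    rw [disjoint_iff_inf_le]
    calc X ⊓ (B ⊓ E) ≤ (B ⊓ X) ⊓ E := by
          rw [← inf_assoc, inf_comm X B]
      _ ≤ ⊥ := hE.disjoint.le_bot
  refine ⟨B ⊓ E, (B ⊓ E) ⊔ C, le_sup_left, ⟨?_, ?_⟩, hsup, ?_⟩
  · exact hd2.disjoint_sup_right_of_disjoint_sup_left (by rw [hXB]; exact hC.disjoint)
  · rw [codisjoint_iff, ← sup_assoc, hXB, hC.sup_eq_top]
  · rw [← finrank_disj hdis, hsup]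

lemma transitive {F V : Type*} [Field F] [AddCommGroup V] [Module F V]
    [FiniteDimensional F V] (X B B' : Submodule F V) (hB : finrank F B = finrank F B')
    (hX : finrank F (B ⊓ X : Submodule F V) = finrank F (B' ⊓ X : Submodule F V)) :
    ∃ g : V ≃ₗ[F] V, X.map (g : V →ₗ[F] V) = X ∧ B.map (g : V →ₗ[F] V) = B' := by
  obtain ⟨B1, D, h1, h2, h3, h4⟩ := decomp X B
  obtain ⟨B1', D', h1', h2', h3', h4'⟩ := decomp X B'
  have h5 := Submodule.finrank_add_eq_of_isCompl h2
  have h6 := Submodule.finrank_add_eq_of_isCompl h2'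
  obtain ⟨e₁, he₁⟩ := exists_equiv_sub (B ⊓ X) X (B' ⊓ X) X inf_le_right inf_le_right hX rfl
  obtain ⟨e₂, he₂⟩ := exists_equiv_sub B1 D B1' D' h1 h1' (by omega) (by omega)
  obtain ⟨g, hg1, hg2⟩ := ext_compl h2 h2' e₁ e₂
  refine ⟨g, map_eq_of_ext _ _ hg1, ?_⟩
  rw [← h3, Submodule.map_sup, he₁ g hg1, he₂ g hg2, h3']

lemma exists_betw {F V : Type*} [Field F] [AddCommGroup V] [Module F V]
    [FiniteDimensional F V] (B D : Submodule F V) (hBD : B ≤ D) (k : ℕ) (h1 : finrank F B ≤ k)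
    (h2 : k ≤ finrank F D) : ∃ K, B ≤ K ∧ K ≤ D ∧ finrank F K = k := by
  induction k, h1 using Nat.le_induction with
  | base => exact ⟨B, le_rfl, hBD, rfl⟩
  | succ k hk ih =>
    obtain ⟨K, hK1, hK2, hK3⟩ := ih (by omega)
    have hlt : K < D := lt_of_le_of_ne hK2 (by rintro rfl; omega)
    obtain ⟨x, hxD, hxK⟩ := SetLike.exists_of_lt hlt
    refine ⟨K ⊔ Submodule.span F {x}, hK1.trans le_sup_left, sup_le hK2 (by simpa using hxD), ?_⟩
    have hx0 : x ≠ 0 := by rintro rfl; exact hxK K.zero_mem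
    rw [finrank_disj, finrank_span_singleton hx0, hK3]
    exact (Submodule.disjoint_span_singleton' hx0).2 hxK

lemma exists_K {F V : Type*} [Field F] [AddCommGroup V] [Module F V]
    [FiniteDimensional F V] (X B : Submodule F V) (k : ℕ) (h1 : finrank F B ≤ k)
    (h2 : finrank F X + k ≤ finrank F V) :
    ∃ K, B ≤ K ∧ finrank F K = k ∧
      finrank F (K ⊓ X : Submodule F V) = finrank F (B ⊓ X : Submodule F V) := by
  obtain ⟨C, hC⟩ := (X ⊔ B).exists_isCompl
  have e1 := Submodule.finrank_add_eq_of_isCompl hC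
  have e2 := Submodule.finrank_sup_add_finrank_inf_eq X B
  have e3 := finrank_disj (hC.disjoint.mono_left (le_sup_right : B ≤ X ⊔ B))
  have e4 := Submodule.finrank_sup_add_finrank_inf_eq (B ⊔ C) X
  have e5 : (B ⊔ C) ⊔ X = ⊤ := by rw [sup_comm, ← sup_assoc, hC.sup_eq_top]
  rw [e5, finrank_top] at e4
  rw [inf_comm X B] at e2
  obtain ⟨K, hK1, hK2, hK3⟩ := exists_betw B (B ⊔ C) le_sup_left k h1 (by omega)
  refine ⟨K, hK1, hK3, ?_⟩
  have a1 := Submodule.finrank_mono (inf_le_inf_right X hK1)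
  have a2 := Submodule.finrank_mono (inf_le_inf_right X hK2)
  omega

open Classical in
lemma core {F V : Type*} [Field F] [AddCommGroup V] [Module F V] [FiniteDimensional F V]
    [Fintype (Submodule F V)] (j k : ℕ) (hjk : j ≤ k) (hm : j + k ≤ finrank F V)
    (f : Submodule F V → ℚ)
    (hf : ∀ K : Submodule F V, finrank F K = k →
      ∑ B : Submodule F V with (finrank F (B : Submodule F V) = j ∧ B ≤ K), f B = 0)
    (X : Submodule F V) (hX : finrank F X = j) : f X = 0 := by
  have key : ∀ s ≤ j, ∑ B : Submodule F V with
      (finrank F (B : Submodule F V) = j ∧ finrank F (B ⊓ X : Submodule F V) = s), f B = 0 := by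
    intro s
    induction s using Nat.strong_induction_on with
    | _ s ih =>
    intro hs
    let n : Submodule F V → ℕ := fun B => Finset.card {K : Submodule F V |
      B ≤ K ∧ finrank F K = k ∧ finrank F (K ⊓ X : Submodule F V) = s}
    have hn : ∀ B B' : Submodule F V, finrank F B = j → finrank F B' = j →
        finrank F (B ⊓ X : Submodule F V) = finrank F (B' ⊓ X : Submodule F V) → n B = n B' := by
      intro B B' hB hB' h
      obtain ⟨g, hgX, hgB⟩ := transitive X B B' (hB.trans hB'.symm) h
      refine Finset.card_bij' (fun K _ => K.map (g : V →ₗ[F] V))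
        (fun K _ => K.map (g.symm : V →ₗ[F] V)) ?_ ?_ ?_ ?_
      · intro K hK
        simp only [Finset.mem_filter, Finset.mem_univ, true_and] at hK ⊢
        refine ⟨hgB ▸ Submodule.map_mono hK.1, ?_, ?_⟩
        · rw [LinearEquiv.finrank_map_eq]; exact hK.2.1
        · conv_lhs => rw [← hgX, ← Submodule.map_inf _ g.injective]
          exact (LinearEquiv.finrank_map_eq g _).trans hK.2.2
      · intro K hK
        have hgX' : X.map (g.symm : V →ₗ[F] V) = X := by
          conv_lhs => rw [← hgX, ← Submodule.map_comp]
          simp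
        have hgB' : B'.map (g.symm : V →ₗ[F] V) = B := by
          rw [← hgB, ← Submodule.map_comp]
          simp
        simp only [Finset.mem_filter, Finset.mem_univ, true_and] at hK ⊢
        refine ⟨hgB' ▸ Submodule.map_mono hK.1, ?_, ?_⟩
        · rw [LinearEquiv.finrank_map_eq]; exact hK.2.1
        · conv_lhs => rw [← hgX', ← Submodule.map_inf _ g.symm.injective]
          exact (LinearEquiv.finrank_map_eq g.symm _).trans hK.2.2
      · intro K _
        simp [← Submodule.map_comp]
      · intro K _
        simp [← Submodule.map_comp]
    have h0 : ∑ B : Submodule F V with finrank F (B : Submodule F V) = j, (n B : ℚ) * f B = 0 := by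
      have : ∑ K : Submodule F V with (finrank F (K : Submodule F V) = k ∧ finrank F (K ⊓ X : Submodule F V) = s),
          ∑ B : Submodule F V with (finrank F (B : Submodule F V) = j ∧ B ≤ K), f B = 0 :=
        Finset.sum_eq_zero fun K hK => hf K (by simp at hK; exact hK.1)
      rw [Finset.sum_comm' (t' := {B : Submodule F V | finrank F B = j})
        (s' := fun B => {K : Submodule F V |
      B ≤ K ∧ finrank F K = k ∧ finrank F (K ⊓ X : Submodule F V) = s})] at this
      · simpa [n] using this
      · intro K B; simp; tauto
    -- split by t
    have hfib : ∑ B : Submodule F V with finrank F (B : Submodule F V) = j, (n B : ℚ) * f B =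
        ∑ t ∈ Finset.range (j + 1), ∑ B : Submodule F V with
          (finrank F (B : Submodule F V) = j ∧ finrank F (B ⊓ X : Submodule F V) = t), (n B : ℚ) * f B := by
      rw [← Finset.sum_fiberwise_of_maps_to (t := Finset.range (j + 1))
        (g := fun B : Submodule F V => finrank F (B ⊓ X : Submodule F V))]
      · simp only [Finset.filter_filter]
      · intro B hB
        have := Submodule.finrank_mono (inf_le_right : B ⊓ X ≤ X)
        simp; omega
    rw [hfib, Finset.sum_eq_single s] at h0
    · by_cases hex : ∃ B0 : Submodule F V, finrank F B0 = j ∧ finrank F (B0 ⊓ X : Submodule F V) = s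
      · obtain ⟨B0, hB0, hB0s⟩ := hex
        have hpos : n B0 ≠ 0 := by
          obtain ⟨K, hK1, hK2, hK3⟩ := exists_K X B0 k (by omega) (by omega)
          exact Finset.card_ne_zero.2 ⟨K, by simp; exact ⟨hK1, hK2, hK3.trans hB0s⟩⟩
        rw [Finset.sum_congr rfl (g := fun B => (n B0 : ℚ) * f B), ← Finset.mul_sum] at h0
        · exact (mul_eq_zero.1 h0).resolve_left (by exact_mod_cast hpos)
        · intro B hB
          simp only [Finset.mem_filter, Finset.mem_univ, true_and] at hB
          rw [hn B B0 hB.1 hB0 (hB.2.trans hB0s.symm)]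
      · push Not at hex
        apply Finset.sum_eq_zero
        intro B hB
        simp only [Finset.mem_filter, Finset.mem_univ, true_and] at hB
        exact absurd hB.2 (hex B hB.1)
    · intro t ht hts
      rcases lt_or_gt_of_ne hts with hlt | hgt
      · by_cases hex : ∃ B0 : Submodule F V, finrank F B0 = j ∧ finrank F (B0 ⊓ X : Submodule F V) = t
        · obtain ⟨B0, hB0, hB0s⟩ := hex
          rw [Finset.sum_congr rfl (g := fun B => (n B0 : ℚ) * f B), ← Finset.mul_sum,
            ih t hlt (by omega), mul_zero]
          intro B hB
          simp only [Finset.mem_filter, Finset.mem_univ, true_and] at hB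
          rw [hn B B0 hB.1 hB0 (hB.2.trans hB0s.symm)]
        · push Not at hex
          apply Finset.sum_eq_zero
          intro B hB
          simp only [Finset.mem_filter, Finset.mem_univ, true_and] at hB
          exact absurd hB.2 (hex B hB.1)
      · apply Finset.sum_eq_zero
        intro B hB
        simp only [Finset.mem_filter, Finset.mem_univ, true_and] at hB
        have : n B = 0 := by
          apply Finset.card_eq_zero.2
          rw [Finset.filter_eq_empty_iff]
          rintro K - ⟨h1, h2, h3⟩
          have := Submodule.finrank_mono (inf_le_inf_right X h1)
          omega
        simp [this]
    · intro h; exact absurd (Finset.mem_range.2 (by omega)) h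
  have := key j le_rfl
  rw [Finset.sum_eq_single X] at this
  · exact this
  · intro B hB hne
    simp only [Finset.mem_filter, Finset.mem_univ, true_and] at hB
    exfalso; apply hne
    have h1 : B ⊓ X = B := Submodule.eq_of_le_of_finrank_eq inf_le_left (by omega)
    have h2 : B ⊓ X = X := Submodule.eq_of_le_of_finrank_eq inf_le_right (by omega)
    rw [← h1, h2]
  · intro h
    simp only [Finset.mem_filter, Finset.mem_univ, true_and] at h
    exact absurd ⟨hX, by rw [inf_idem]; exact hX⟩ h

open Classical in
lemma core_transfer {F V W : Type*} [Field F] [AddCommGroup V] [Module F V]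
    [AddCommGroup W] [Module F W] [FiniteDimensional F W]
    [Fintype (Submodule F V)] [Fintype (Submodule F W)] (j k : ℕ) (hjk : j ≤ k)
    (hm : j + k ≤ finrank F W) (ψ : Submodule F W → Submodule F V) (hψ : Function.Injective ψ)
    (R : Submodule F V → Submodule F V → Prop) (hR : ∀ C D, R (ψ C) (ψ D) ↔ C ≤ D)
    (S : Submodule F V → Prop) (hS : ∀ B, S B ↔ ∃ C, ψ C = B) (j' k' : ℕ)
    (hj : ∀ C : Submodule F W, finrank F C = j ↔ finrank F (ψ C) = j')
    (hk : ∀ C : Submodule F W, finrank F C = k ↔ finrank F (ψ C) = k')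
    (f : Submodule F V → ℚ)
    (hf : ∀ K : Submodule F V, S K → finrank F K = k' →
      ∑ B with (S B ∧ finrank F (B : Submodule F V) = j' ∧ R B K), f B = 0)
    (X : Submodule F V) (hXS : S X) (hX : finrank F X = j') : f X = 0 := by
  obtain ⟨C, rfl⟩ := (hS X).1 hXS
  refine core j k hjk hm (fun C => f (ψ C)) ?_ C ((hj C).2 hX)
  intro K hK
  rw [← hf (ψ K) ((hS _).2 ⟨K, rfl⟩) ((hk K).1 hK)]
  refine Finset.sum_nbij ψ ?_ (hψ.injOn) ?_ (fun _ _ => rfl)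
  · intro B hB
    simp only [Finset.mem_filter, Finset.mem_univ, true_and] at hB ⊢
    exact ⟨(hS _).2 ⟨B, rfl⟩, (hj B).1 hB.1, (hR _ _).2 hB.2⟩
  · intro B hB
    simp only [Finset.coe_filter, Finset.mem_univ, true_and, Set.mem_ofPred_eq] at hB
    obtain ⟨h1, h2, h3⟩ := hB
    obtain ⟨C', rfl⟩ := (hS B).1 h1
    exact ⟨C', by simpa using ⟨(hj _).2 h2, (hR _ _).1 h3⟩, rfl⟩

lemma exists_psi {F V : Type*} [Field F] [AddCommGroup V] [Module F V] [FiniteDimensional F V]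
    (P Q : Submodule F V) (hPQ : P ≤ Q) :
    ∃ ψ : Submodule F (Q ⧸ P.submoduleOf Q) → Submodule F V,
      (∀ C D, ψ C ≤ ψ D ↔ C ≤ D) ∧ (∀ B, (P ≤ B ∧ B ≤ Q) ↔ ∃ C, ψ C = B) ∧
      (∀ C, finrank F (ψ C) = finrank F C + finrank F P) := by
  refine ⟨fun C => (C.comap (P.submoduleOf Q).mkQ).map Q.subtype, ?_, ?_, ?_⟩
  · intro C D
    rw [Submodule.map_le_map_iff_of_injective Q.injective_subtype]
    exact Submodule.comap_le_comap_iff_of_surjective (Submodule.mkQ_surjective _)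
  · intro B
    constructor
    · rintro ⟨h1, h2⟩
      refine ⟨(B.submoduleOf Q).map (P.submoduleOf Q).mkQ, ?_⟩
      simp only
      rw [Submodule.comap_map_mkQ, sup_eq_right.2 (Submodule.comap_mono h1)]
      simp [Submodule.submoduleOf, Submodule.map_comap_subtype, h2]
    · rintro ⟨C, rfl⟩
      refine ⟨?_, Submodule.map_subtype_le _ _⟩
      have : P = (P.submoduleOf Q).map Q.subtype := by
        simp [Submodule.submoduleOf, Submodule.map_comap_subtype, hPQ]
      conv_lhs => rw [this]
      exact Submodule.map_mono (Submodule.le_comap_mkQ _ _)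
  · intro C
    simp only
    rw [← (Submodule.equivMapOfInjective Q.subtype Q.injective_subtype _).finrank_eq]
    have hle : P.submoduleOf Q ≤ C.comap (P.submoduleOf Q).mkQ := Submodule.le_comap_mkQ _ _
    have e := (Submodule.quotientQuotientEquivQuotient _ _ hle).finrank_eq
    rw [Submodule.map_comap_eq_of_surjective (Submodule.mkQ_surjective _)] at e
    have h1 := Submodule.finrank_quotient_add_finrank (P.submoduleOf Q)
    have h2 := Submodule.finrank_quotient_add_finrank C
    have h3 := Submodule.finrank_quotient_add_finrank (C.comap (P.submoduleOf Q).mkQ)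
    rw [(Submodule.submoduleOfEquivOfLe hPQ).finrank_eq] at h1
    omega

open Classical in
lemma interval_up {F V : Type*} [Field F] [Finite F] [AddCommGroup V] [Module F V]
    [FiniteDimensional F V]
    [Fintype (Submodule F V)] (j k m : ℕ) (hjk : j ≤ k)
    (hm : j + k ≤ m) (P Q : Submodule F V) (hPQ : P ≤ Q)
    (hQ : finrank F Q = finrank F P + m)
    (f : Submodule F V → ℚ)
    (hf : ∀ K : Submodule F V, (P ≤ K ∧ K ≤ Q) → finrank F K = finrank F P + k →
      ∑ B with ((P ≤ B ∧ B ≤ Q) ∧ finrank F (B : Submodule F V) = finrank F P + j ∧ B ≤ K), f B = 0)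
    (X : Submodule F V) (hXS : (P ≤ X ∧ X ≤ Q)) (hX : finrank F X = finrank F P + j) : f X = 0 := by
  obtain ⟨ψ, h1, h2, h3⟩ := exists_psi P Q hPQ
  have : Finite (Q ⧸ P.submoduleOf Q) := Module.finite_of_finite F
  have := Fintype.ofFinite (Submodule F (Q ⧸ P.submoduleOf Q))
  have hd := Submodule.finrank_quotient_add_finrank (P.submoduleOf Q)
  rw [(Submodule.submoduleOfEquivOfLe hPQ).finrank_eq] at hd
  refine core_transfer j k hjk (by omega) ψ ?_ (fun B K => B ≤ K) h1 (fun B => P ≤ B ∧ B ≤ Q) h2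
    (finrank F P + j) (finrank F P + k) ?_ ?_ f (fun K h1 h2 => by convert hf K h1 h2) X hXS hX
  · intro C D h
    exact le_antisymm ((h1 _ _).1 h.le) ((h1 _ _).1 h.ge)
  · intro C; rw [h3]; omega
  · intro C; rw [h3]; omega

open Classical in
lemma interval_down {F V : Type*} [Field F] [Finite F] [AddCommGroup V] [Module F V]
    [FiniteDimensional F V]
    [Fintype (Submodule F V)] (j k m : ℕ) (hjk : k ≤ j) (hj : j ≤ m)
    (hm : m ≤ j + k) (P Q : Submodule F V) (hPQ : P ≤ Q)
    (hQ : finrank F Q = finrank F P + m)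
    (f : Submodule F V → ℚ)
    (hf : ∀ K : Submodule F V, (P ≤ K ∧ K ≤ Q) → finrank F K = finrank F P + k →
      ∑ B with ((P ≤ B ∧ B ≤ Q) ∧ finrank F (B : Submodule F V) = finrank F P + j ∧ K ≤ B), f B = 0)
    (X : Submodule F V) (hXS : (P ≤ X ∧ X ≤ Q)) (hX : finrank F X = finrank F P + j) : f X = 0 := by
  obtain ⟨ψ, h1, h2, h3⟩ := exists_psi P Q hPQ
  have : Finite (Q ⧸ P.submoduleOf Q) := Module.finite_of_finite F
  have : Finite (Dual F (Q ⧸ P.submoduleOf Q)) := Module.finite_of_finite F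
  have := Fintype.ofFinite (Submodule F (Dual F (Q ⧸ P.submoduleOf Q)))
  have hd := Submodule.finrank_quotient_add_finrank (P.submoduleOf Q)
  rw [(Submodule.submoduleOfEquivOfLe hPQ).finrank_eq] at hd
  let φ := Subspace.orderIsoFiniteDimensional (K := F) (V := Q ⧸ P.submoduleOf Q)
  let θ : Submodule F (Dual F (Q ⧸ P.submoduleOf Q)) → Submodule F (Q ⧸ P.submoduleOf Q) :=
    fun C => φ.symm (OrderDual.toDual C)
  have hθ : ∀ C D, θ C ≤ θ D ↔ D ≤ C := fun C D => by
    simp [θ]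
  have hθr : ∀ C : Submodule F (Dual F (Q ⧸ P.submoduleOf Q)), finrank F C + finrank F (θ C) = m := fun C => by
    have := Subspace.finrank_add_finrank_dualCoannihilator_eq C
    have h : θ C = C.dualCoannihilator := rfl
    rw [h]; omega
  refine core_transfer (m - j) (m - k) (by omega) (by rw [Subspace.dual_finrank_eq]; omega)
    (fun C => ψ (θ C)) ?_ (fun B K => K ≤ B)
    (fun C D => (h1 _ _).trans (hθ _ _)) (fun B => P ≤ B ∧ B ≤ Q) ?_
    (finrank F P + j) (finrank F P + k) ?_ ?_ f (fun K h1 h2 => by convert hf K h1 h2) X hXS hX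
  · intro C D h
    exact le_antisymm ((hθ _ _).1 ((h1 _ _).1 h.ge)) ((hθ _ _).1 ((h1 _ _).1 h.le))
  · intro B
    rw [h2]
    constructor
    · rintro ⟨C, rfl⟩
      exact ⟨OrderDual.ofDual (φ C), by simp [θ]⟩
    · rintro ⟨C, rfl⟩
      exact ⟨_, rfl⟩
  · intro C; rw [h3]; have := hθr C; omega
  · intro C; rw [h3]; have := hθr C; omega

open Classical in
lemma interval_both (F V : Type*) [Field F] [Finite F] [AddCommGroup V] [Module F V]
    [FiniteDimensional F V] [Fintype (Submodule F V)] (k l b c : ℕ) (h : b + c = k + l)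
    (h' : b * c ≤ k * l) :
    ∃ R : Submodule F V → Submodule F V → Prop,
      (∀ (g : V ≃ₗ[F] V) B K, R (B.map (g : V →ₗ[F] V)) (K.map (g : V →ₗ[F] V)) ↔ R B K) ∧
      ∀ (P Q : Submodule F V) (f : Submodule F V → ℚ), P ≤ Q →
        finrank F Q = finrank F P + (k + l) →
        (∀ K : Submodule F V, (P ≤ K ∧ K ≤ Q) → finrank F K = finrank F P + k →
          ∑ B with ((P ≤ B ∧ B ≤ Q) ∧ finrank F (B : Submodule F V) = finrank F P + b ∧ R B K),
            f B = 0) →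
        ∀ X : Submodule F V, (P ≤ X ∧ X ≤ Q) → finrank F X = finrank F P + b → f X = 0 := by
  have hmin : (b ≤ k ∧ b ≤ l) ∨ (c ≤ k ∧ c ≤ l) := by
    by_contra hcon
    have : (k < b ∨ l < b) ∧ (k < c ∨ l < c) := by omega
    obtain ⟨h1 | h1, h2 | h2⟩ := this
    · obtain ⟨x, rfl⟩ := Nat.exists_eq_add_of_lt h1
      obtain ⟨y, rfl⟩ := Nat.exists_eq_add_of_lt h2
      obtain rfl : l = x + y + k + 2 := by omega
      nlinarith
    · omega
    · omega
    · obtain ⟨x, rfl⟩ := Nat.exists_eq_add_of_lt h1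
      obtain ⟨y, rfl⟩ := Nat.exists_eq_add_of_lt h2
      obtain rfl : k = x + y + l + 2 := by omega
      nlinarith
  rcases hmin with hb | hc
  · refine ⟨fun B K => B ≤ K, fun g B K => Submodule.map_le_map_iff_of_injective g.injective B K, ?_⟩
    intro P Q f hPQ hQ hf X
    exact interval_up b k (k + l) (by omega) (by omega) P Q hPQ hQ f hf X
  · refine ⟨fun B K => K ≤ B, fun g B K => Submodule.map_le_map_iff_of_injective g.injective K B, ?_⟩
    intro P Q f hPQ hQ hf X
    exact interval_down b k (k + l) (by omega) (by omega) (by omega) P Q hPQ hQ f hf X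

lemma card_classes_le {κ ι : Type*} [Finite κ] [Finite ι] (r : Setoid κ) (s : Setoid ι)
    (T : (κ → ℚ) →ₗ[ℚ] (ι → ℚ)) (hinj : ∀ h, T h = 0 → h = 0)
    (hinv : ∀ h, (∀ x y, r x y → h x = h y) → ∀ x y, s x y → T h x = T h y) :
    Nat.card r.classes ≤ Nat.card s.classes := by
  rw [← Nat.card_congr (Setoid.quotientEquivClasses r), ← Nat.card_congr (Setoid.quotientEquivClasses s)]
  classical
  have := Fintype.ofFinite (Quotient r)
  have := Fintype.ofFinite (Quotient s)
  let π : (Quotient r → ℚ) →ₗ[ℚ] (κ → ℚ) := LinearMap.funLeft ℚ ℚ (Quotient.mk r)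
  let σ : (ι → ℚ) →ₗ[ℚ] (Quotient s → ℚ) := LinearMap.funLeft ℚ ℚ Quotient.out
  have hi : Function.Injective (σ ∘ₗ T ∘ₗ π) := by
    rw [← LinearMap.ker_eq_bot, LinearMap.ker_eq_bot']
    intro h hh
    have hc : ∀ x y, r x y → π h x = π h y := fun x y hxy => congrArg h (Quotient.sound hxy)
    have h0 : π h = 0 := by
      apply hinj
      funext A
      have h1 : T (π h) (Quotient.out (Quotient.mk s A)) = 0 := congrFun hh (Quotient.mk s A)
      refine Eq.trans ?_ h1
      exact hinv _ hc _ _ (s.symm (Quotient.mk_out A))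
    funext q
    induction q using Quotient.inductionOn with
    | _ x => exact congrFun h0 x
  have := LinearMap.finrank_le_finrank_of_injective hi
  rw [Module.finrank_fintype_fun_eq_card, Module.finrank_fintype_fun_eq_card] at this
  simpa [Nat.card_eq_fintype_card] using this

lemma flag_update {F V : Type*} [Field F] [AddCommGroup V] [Module F V]
    {r : ℕ} (a a' : Fin r → ℕ) (i : ℕ) (hi : i + 1 < r)
    (hoff : ∀ t : Fin r, t.val ≠ i → t.val ≠ i + 1 → a t = a' t)
    (hs : a ⟨i, by omega⟩ + a ⟨i + 1, hi⟩ = a' ⟨i, by omega⟩ + a' ⟨i + 1, hi⟩)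
    (f : Fin (r + 1) → Submodule F V) (hf : IsFlagOfType a f) (K : Submodule F V)
    (h1 : f ⟨i, by omega⟩ ≤ K) (h2 : K ≤ f ⟨i + 2, by omega⟩)
    (h3 : finrank F K = finrank F (f ⟨i, by omega⟩) + a' ⟨i, by omega⟩) :
    IsFlagOfType a' (Function.update f ⟨i + 1, by omega⟩ K) := by
  obtain ⟨hm, h0, hl, hd⟩ := hf
  have hne : ∀ t : Fin (r + 1), t.val ≠ i + 1 →
      Function.update f ⟨i + 1, by omega⟩ K t = f t := fun t ht =>
    Function.update_of_ne (by rintro rfl; exact ht rfl) _ _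
  have heq : ∀ t : Fin (r + 1), t.val = i + 1 →
      Function.update f ⟨i + 1, by omega⟩ K t = K := by
    rintro ⟨t, ht⟩ h
    simp only at h
    subst h
    exact Function.update_self _ _ _
  refine ⟨?_, ?_, ?_, ?_⟩
  · rw [Fin.monotone_iff_le_succ]
    intro t
    by_cases ht1 : t.val = i
    · rw [hne _ (by simp; omega), heq _ (by simp; omega)]
      convert h1
      simp [ht1]
    · by_cases ht2 : t.val = i + 1
      · rw [heq _ (by simp; omega), hne _ (by simp; omega)]
        convert h2
        simp [ht2]
      · rw [hne _ (by simp; omega), hne _ (by simp; omega)]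
        exact hm (Fin.castSucc_le_succ t)
  · rw [hne _ (by simp), h0]
  · rw [hne _ (by simp; omega), hl]
  · intro t
    by_cases ht1 : t.val = i
    · rw [hne t.castSucc (by simp; omega), heq t.succ (by simp; omega)]
      obtain ⟨t, htr⟩ := t
      simp only at ht1
      subst ht1
      exact h3
    · by_cases ht2 : t.val = i + 1
      · rw [heq t.castSucc (by simp; omega), hne t.succ (by simp; omega)]
        obtain ⟨t, htr⟩ := t
        simp only at ht2
        subst ht2
        have e1 := hd ⟨i, by omega⟩
        have e2 := hd ⟨i + 1, hi⟩
        simp only [Fin.succ_mk, Fin.castSucc_mk] at e1 e2 ⊢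
        omega
      · rw [hne t.castSucc (by simp; omega), hne t.succ (by simp; omega), hd, hoff t ht1 ht2]

lemma flag_map {F V : Type*} [Field F] [AddCommGroup V] [Module F V]
    {r : ℕ} {a : Fin r → ℕ} {f : Fin (r + 1) → Submodule F V} (hf : IsFlagOfType a f)
    (g : V ≃ₗ[F] V) : IsFlagOfType a (fun t => (f t).map (g : V →ₗ[F] V)) := by
  obtain ⟨hm, h0, hl, hd⟩ := hf
  refine ⟨fun s t hst => Submodule.map_mono (hm hst), by simp [h0], ?_, ?_⟩
  · simp only [hl, Submodule.map_top]
    exact LinearEquiv.range g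
  · intro t
    simp only [LinearEquiv.finrank_map_eq]
    exact hd t

/-- the orbit equivalence relation on flags -/
def flagSetoid {F V G : Type*} [Field F] [AddCommGroup V] [Module F V]
    [Group G] (ρ : G →* (V ≃ₗ[F] V)) {r : ℕ} (a : Fin r → ℕ) :
    Setoid {f : Fin (r + 1) → Submodule F V // IsFlagOfType a f} where
  r f f₀ := ∃ g : G, (f : Fin (r + 1) → Submodule F V) =
          fun i => Submodule.map ((ρ g) : V →ₗ[F] V) (f₀.1 i)
  iseqv := by
    refine ⟨?_, ?_, ?_⟩
    · intro f
      refine ⟨1, ?_⟩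
      funext t
      rw [map_one]
      exact (Submodule.map_id _).symm
    · rintro f f' ⟨g, hg⟩
      refine ⟨g⁻¹, ?_⟩
      funext t
      rw [hg, ← Submodule.map_comp, map_inv]
      have : ((ρ g)⁻¹ : V ≃ₗ[F] V).toLinearMap ∘ₗ (ρ g : V →ₗ[F] V) = LinearMap.id := by
        ext x
        exact (ρ g).symm_apply_apply x
      rw [this, Submodule.map_id]
    · rintro f f' f'' ⟨g, hg⟩ ⟨g', hg'⟩
      refine ⟨g * g', ?_⟩
      funext t
      rw [hg, hg']
      simp only
      rw [← Submodule.map_comp, map_mul]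
      rfl

/-- action of a linear automorphism on flags -/
def flagEquiv {F V : Type*} [Field F] [AddCommGroup V] [Module F V]
    (g : V ≃ₗ[F] V) {r : ℕ} (a : Fin r → ℕ) :
    {f : Fin (r + 1) → Submodule F V // IsFlagOfType a f} ≃
    {f : Fin (r + 1) → Submodule F V // IsFlagOfType a f} where
  toFun f := ⟨_, flag_map f.2 g⟩
  invFun f := ⟨_, flag_map f.2 g.symm⟩
  left_inv f := by
    apply Subtype.ext
    funext t
    simp [← Submodule.map_comp]
  right_inv f := by
    apply Subtype.ext
    funext t
    simp [← Submodule.map_comp]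

theorem stmt8 {F V G : Type*} [Field F] [Fintype F] [AddCommGroup V] [Module F V]
    [FiniteDimensional F V] [Group G] (ρ : G →* (V ≃ₗ[F] V))
    (n r : ℕ) (hn : Module.finrank F V = n) (a : Fin r → ℕ) (ha : ∑ t, a t = n)
    (i : ℕ) (hi : i + 1 < r) (b c : ℕ)
    (hbc : b + c = a ⟨i, Nat.lt_of_succ_lt hi⟩ + a ⟨i + 1, hi⟩)
    (hbc' : b * c ≤ a ⟨i, Nat.lt_of_succ_lt hi⟩ * a ⟨i + 1, hi⟩) :
    flagOrbitCount F V G ρ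
        (Function.update (Function.update a ⟨i, Nat.lt_of_succ_lt hi⟩ b) ⟨i + 1, hi⟩ c)
      ≤ flagOrbitCount F V G ρ a := by
  classical
  have : Finite V := Module.finite_of_finite F
  have := Fintype.ofFinite (Submodule F V)
  set a' := Function.update (Function.update a ⟨i, Nat.lt_of_succ_lt hi⟩ b) ⟨i + 1, hi⟩ c with ha'
  have hb : a' ⟨i, Nat.lt_of_succ_lt hi⟩ = b := by
    rw [ha', Function.update_of_ne (by simp [Fin.ext_iff]), Function.update_self]
  have hc : a' ⟨i + 1, hi⟩ = c := by
    rw [ha', Function.update_self]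
  have hoff : ∀ t : Fin r, t.val ≠ i → t.val ≠ i + 1 → a' t = a t := by
    intro t h1 h2
    rw [ha', Function.update_of_ne (by rintro rfl; exact h2 rfl),
      Function.update_of_ne (by rintro rfl; exact h1 rfl)]
  clear_value a'
  obtain ⟨R, hRg, hR⟩ := interval_both F V _ _ b c hbc hbc'
  let M : Fin (r + 1) := ⟨i + 1, by omega⟩
  let N : {f : Fin (r + 1) → Submodule F V // IsFlagOfType a f} →
      {f : Fin (r + 1) → Submodule F V // IsFlagOfType a' f} → Prop :=
    fun A B => (∀ t, t ≠ M → B.1 t = A.1 t) ∧ R (B.1 M) (A.1 M)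
  let T : ({f : Fin (r + 1) → Submodule F V // IsFlagOfType a' f} → ℚ) →ₗ[ℚ]
      ({f : Fin (r + 1) → Submodule F V // IsFlagOfType a f} → ℚ) :=
    { toFun := fun h A => ∑ B with N A B, h B
      map_add' := fun h h' => by funext A; simp [Finset.sum_add_distrib]
      map_smul' := fun c h => by funext A; simp [Finset.mul_sum] }
  refine card_classes_le (flagSetoid ρ a') (flagSetoid ρ a) T ?_ ?_
  · intro h hh
    funext B0
    have hLM : (⟨i, by omega⟩ : Fin (r + 1)) ≠ M := by simp [M, Fin.ext_iff]
    have hUM : (⟨i + 2, by omega⟩ : Fin (r + 1)) ≠ M := by simp [M, Fin.ext_iff]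
    have hLM' : (⟨i, by omega⟩ : Fin (r + 1)) ≤ M := by simp [M]
    have hUM' : M ≤ (⟨i + 2, by omega⟩ : Fin (r + 1)) := by simp [M]
    have hd1 := B0.2.2.2.2 ⟨i, by omega⟩
    have hd2 := B0.2.2.2.2 ⟨i + 1, by omega⟩
    simp only [Fin.succ_mk, Fin.castSucc_mk] at hd1 hd2
    rw [hb] at hd1
    rw [hc] at hd2
    change finrank F (B0.1 ⟨i + 2, by omega⟩) = _ at hd2
    have hflag : ∀ C, (B0.1 ⟨i, by omega⟩ ≤ C ∧ C ≤ B0.1 ⟨i + 2, by omega⟩) →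
        finrank F C = finrank F (B0.1 ⟨i, by omega⟩) + b →
        IsFlagOfType a' (Function.update B0.1 M C) := fun C h1 h2 =>
      flag_update a' a' i hi (fun _ _ _ => rfl) rfl B0.1 B0.2 C h1.1 h1.2 (by rw [hb]; exact h2)
    let f : Submodule F V → ℚ := fun C =>
      if hC : IsFlagOfType a' (Function.update B0.1 M C) then h ⟨_, hC⟩ else 0
    have key := hR (B0.1 ⟨i, by omega⟩) (B0.1 ⟨i + 2, by omega⟩) f
      (B0.2.1 (hLM'.trans hUM')) (by omega) ?_ (B0.1 M) ⟨B0.2.1 hLM', B0.2.1 hUM'⟩ hd1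
    · have e : Function.update B0.1 M (B0.1 M) = B0.1 := Function.update_eq_self _ _
      have e2 : IsFlagOfType a' (Function.update B0.1 M (B0.1 M)) := by rw [e]; exact B0.2
      simp only [f] at key
      rw [dif_pos e2] at key
      have e3 : (⟨_, e2⟩ : {f : Fin (r + 1) → Submodule F V // IsFlagOfType a' f}) = B0 :=
        Subtype.ext e
      rw [e3] at key
      exact key
    · intro K hK hKd
      have hA : IsFlagOfType a (Function.update B0.1 M K) :=
        flag_update a' a i hi hoff (by rw [hb, hc, hbc]) B0.1 B0.2 K hK.1 hK.2 hKd
      have h0 : ∑ B with N ⟨_, hA⟩ B, h B = 0 := congrFun hh ⟨_, hA⟩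
      rw [← h0]
      symm
      refine Finset.sum_bij (fun B _ => B.1 M) ?_ ?_ ?_ ?_
      · intro B hB
        simp only [Finset.mem_filter, Finset.mem_univ, true_and, N] at hB ⊢
        obtain ⟨h1, h2⟩ := hB
        rw [Function.update_self] at h2
        have eL := h1 _ hLM
        have eU := h1 _ hUM
        rw [Function.update_of_ne hLM] at eL
        rw [Function.update_of_ne hUM] at eU
        refine ⟨⟨?_, ?_⟩, ?_, h2⟩
        · rw [← eL]; exact B.2.1 hLM'
        · rw [← eU]; exact B.2.1 hUM'
        · rw [← eL, ← hb]; exact B.2.2.2.2 ⟨i, by omega⟩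
      · intro B hB B' hB' hBB
        simp only [Finset.mem_filter, Finset.mem_univ, true_and, N] at hB hB'
        apply Subtype.ext
        funext t
        by_cases ht : t = M
        · rw [ht]; exact hBB
        · rw [hB.1 t ht, hB'.1 t ht]
      · intro C hC
        simp only [Finset.mem_filter, Finset.mem_univ, true_and] at hC
        refine ⟨⟨_, hflag C hC.1 hC.2.1⟩, ?_, Function.update_self _ _ _⟩
        simp only [Finset.mem_filter, Finset.mem_univ, true_and, N]
        refine ⟨fun t ht => by rw [Function.update_of_ne ht, Function.update_of_ne ht], ?_⟩
        rw [Function.update_self, Function.update_self]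
        exact hC.2.2
      · intro B hB
        simp only [Finset.mem_filter, Finset.mem_univ, true_and, N] at hB
        have e : Function.update B0.1 M (B.1 M) = B.1 := by
          funext t
          by_cases ht : t = M
          · rw [ht, Function.update_self]
          · rw [Function.update_of_ne ht, hB.1 t ht, Function.update_of_ne ht]
        have e2 : IsFlagOfType a' (Function.update B0.1 M (B.1 M)) := by rw [e]; exact B.2
        simp only [f]
        rw [dif_pos e2]
        congr 1
        exact Subtype.ext e.symm
  · rintro h hinv A A' ⟨g, hg⟩
    change ∑ B with N A B, h B = ∑ B with N A' B, h B
    symm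
    refine Finset.sum_equiv (flagEquiv (ρ g) a') ?_ ?_
    · intro B
      simp only [Finset.mem_filter, Finset.mem_univ, true_and, N, flagEquiv, Equiv.coe_fn_mk]
      rw [hg]
      simp only [hRg, (Submodule.map_injective_of_injective (ρ g).injective).eq_iff]
    · intro B _
      exact hinv _ _ ((flagSetoid ρ a').symm ⟨g, rfl⟩)
end
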